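/- There exist absolute constants c > 0, C > 0 and C' > 0 such that the following holds. Fix integers p ≥ 1, n ≥ 2, m ≥ n with m ≤ np and a sparsity level s with 2 ≤ s ≤ np, and suppose m ≥ c · s · (log(np))⁶. Let Φ^lin be the random (m+n−1) × (np) concatenated linear-convolution matrix built from i.i.d. N(0, 1/m) probe samples. Then with probability at least 1 − C'(np)⁻¹ over the probe samples, the following holds simultaneously for every h ∈ ℝ^{np}, every ε ≥ 0, and every error vector e ∈ ℝ^{m+n−1} with ‖e‖₂ ≤ ε: setting y = Φ^lin h + e, every vector h̃ ∈ ℝ^{np} satisfying ‖Φ^lin h̃ − y‖₂ ≤ ε and ‖h̃‖₁ ≤ ‖h‖₁ (in particular, every minimizer of ‖x‖₁ subject to ‖Φ^lin x − y‖₂ ≤ ε) obeys ‖h̃ − h‖₂ ≤ C ( √2 · ε + s^{−1/2} ‖h − h_s‖₁ ), where h_s is the best s-term approximation to h. -/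

import Mathlib

open MeasureTheory ProbabilityTheory Matrix

/-- Law of `p·m` i.i.d. real Gaussian probe samples of mean `0` and variance `1/m`. -/
noncomputable def gaussMeasure (p m : ℕ) : Measure (Fin p → Fin m → ℝ) :=
  Measure.pi fun _ => Measure.pi fun _ => gaussianReal 0 ((m : NNReal))⁻¹

/-- The `(m+n−1) × (np)` concatenated linear-convolution (Toeplitz) matrix:
the `i`-th block has entries `(Φ^lin_i)_{j,k} = φ_i(j−k+1)` when `1 ≤ j−k+1 ≤ m`
(1-indexed), and `0` otherwise. -/
def linProbeMatrix (p n m : ℕ) (φ : Fin p → Fin m → ℝ) :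
    Matrix (Fin (m + n - 1)) (Fin p × Fin n) ℝ :=
  Matrix.of fun j ik =>
    if h : (ik.2 : ℕ) ≤ (j : ℕ) ∧ (j : ℕ) - (ik.2 : ℕ) < m
      then φ ik.1 ⟨(j : ℕ) - (ik.2 : ℕ), h.2⟩ else 0

/-- The `ℓ₁` norm of a finitely supported real vector. -/
noncomputable def l1 {ι : Type*} [Fintype ι] (x : ι → ℝ) : ℝ := ∑ i, |x i|

/-- The `ℓ₂` (Euclidean) norm of a finitely supported real vector. -/
noncomputable def l2 {ι : Type*} [Fintype ι] (x : ι → ℝ) : ℝ := Real.sqrt (∑ i, (x i) ^ 2)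

/-- `xs` is a best `s`-term approximation to `x`: it agrees with `x` on a set `Γ`
of `s` largest-magnitude entries (of cardinality `min s N`) and vanishes elsewhere. -/
def IsBestApprox {ι : Type*} [Fintype ι] (s : ℕ) (x xs : ι → ℝ) : Prop :=
  ∃ Γ : Finset ι, Γ.card = min s (Fintype.card ι) ∧
    (∀ i ∈ Γ, xs i = x i) ∧ (∀ i ∉ Γ, xs i = 0) ∧
    ∀ i ∈ Γ, ∀ j ∉ Γ, |x j| ≤ |x i|


/-- coefficient array of the `ω`-th cosine transform -/
noncomputable def wv {p n : ℕ} (m ω : ℕ) (z : Fin p × Fin n → ℝ) (i : Fin p) (τ : Fin m) : ℝ :=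
  ∑ k : Fin n, z (i, k) * Real.cos (2 * Real.pi * ω / m * ((τ : ℝ) + k))

noncomputable def SS {p n : ℕ} (m ω : ℕ) (z : Fin p × Fin n → ℝ) : ℝ :=
  (∑ i : Fin p, ∑ τ : Fin m, (wv m ω z i τ) ^ 2) / m

noncomputable def linY {p m : ℕ} (a : Fin p → Fin m → ℝ) (φ : Fin p → Fin m → ℝ) : ℝ :=
  ∑ i, ∑ τ, a i τ * φ i τ

noncomputable def YY {p n : ℕ} (m ω : ℕ) (z : Fin p × Fin n → ℝ) (φ : Fin p → Fin m → ℝ) : ℝ :=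
  linY (wv m ω z) φ

instance gm_prob (p m : ℕ) : IsProbabilityMeasure (gaussMeasure p m) := by
  unfold gaussMeasure; infer_instance

lemma gm_gauss (p m : ℕ) : HasGaussianLaw (fun φ : Fin p → Fin m → ℝ => φ) (gaussMeasure p m) := by
  have h1 : ∀ _i : Fin p, HasGaussianLaw (fun x : Fin m → ℝ => x)
      (Measure.pi fun _ : Fin m => gaussianReal 0 ((m : NNReal))⁻¹) := by
    intro _
    have := iIndepFun.hasGaussianLaw (X := fun (τ : Fin m) (x : Fin m → ℝ) => x τ)
      (P := Measure.pi fun _ : Fin m => gaussianReal 0 ((m : NNReal))⁻¹) (fun τ => ?_) ?_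
    · exact this
    · refine ⟨?_⟩
      have := (measurePreserving_eval (fun _ : Fin m => gaussianReal 0 ((m : NNReal))⁻¹) τ).map_eq
      have h2 : Measure.map (fun x : Fin m → ℝ => x τ)
        (Measure.pi fun _ : Fin m => gaussianReal 0 ((m : NNReal))⁻¹) = gaussianReal 0 ((m : NNReal))⁻¹ := this
      rw [h2]; infer_instance
    · exact iIndepFun_pi (X := fun _ x => x) (fun _ => aemeasurable_id)
  unfold gaussMeasure
  have := iIndepFun.hasGaussianLaw (X := fun (i : Fin p) (x : Fin p → Fin m → ℝ) => x i)
      (P := Measure.pi fun _ : Fin p => Measure.pi fun _ : Fin m => gaussianReal 0 ((m : NNReal))⁻¹) (fun i => ?_) ?_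
  · exact this
  · refine ⟨?_⟩
    have := (measurePreserving_eval (fun _ : Fin p => Measure.pi fun _ : Fin m => gaussianReal 0 ((m : NNReal))⁻¹) i).map_eq
    have h2 : Measure.map (fun x : Fin p → Fin m → ℝ => x i)
        (Measure.pi fun _ : Fin p => Measure.pi fun _ : Fin m => gaussianReal 0 ((m : NNReal))⁻¹)
        = Measure.pi fun _ : Fin m => gaussianReal 0 ((m : NNReal))⁻¹ := this
    rw [h2]; simpa using (h1 i).isGaussian_map
  · exact iIndepFun_pi (X := fun _ x => x) (fun _ => aemeasurable_id)

noncomputable def linYL {p m : ℕ} (a : Fin p → Fin m → ℝ) : (Fin p → Fin m → ℝ) →L[ℝ] ℝ :=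
  ∑ i, ∑ τ, (a i τ) • ((ContinuousLinearMap.proj τ : (Fin m → ℝ) →L[ℝ] ℝ).comp
    (ContinuousLinearMap.proj i : (Fin p → Fin m → ℝ) →L[ℝ] (Fin m → ℝ)))

lemma linYL_apply {p m : ℕ} (a : Fin p → Fin m → ℝ) (φ) : linYL a φ = linY a φ := by
  simp [linYL, linY]

lemma linY_gauss {p m : ℕ} {ι : Type*} [Fintype ι] (a : ι → Fin p → Fin m → ℝ) :
    HasGaussianLaw (fun φ : Fin p → Fin m → ℝ => fun w => linY (a w) φ) (gaussMeasure p m) := by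
  have := (gm_gauss p m).map (ContinuousLinearMap.pi (fun w => linYL (a w)))
  refine this.congr ?_
  filter_upwards with φ
  ext w
  simp [linYL_apply]

lemma linY_gauss1 {p m : ℕ} (a : Fin p → Fin m → ℝ) :
    HasGaussianLaw (linY a) (gaussMeasure p m) := by
  have := (gm_gauss p m).map (linYL a)
  refine this.congr ?_
  filter_upwards with φ
  simp [linYL_apply]

lemma linY_memLp {p m : ℕ} (a : Fin p → Fin m → ℝ) :
    MemLp (linY a) 2 (gaussMeasure p m) := (linY_gauss1 a).memLp_two

lemma var_inner {m : ℕ} (a : Fin m → ℝ) :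
    Var[fun x : Fin m → ℝ => ∑ τ, a τ * x τ;
      Measure.pi fun _ : Fin m => gaussianReal 0 ((m : NNReal))⁻¹] = (∑ τ, a τ ^ 2) / m := by
  have h := variance_sum_pi (μ := fun _ : Fin m => gaussianReal 0 ((m : NNReal))⁻¹)
    (X := fun τ x => a τ * x) (fun τ => by
      have : MemLp (fun x : ℝ => x) 2 (gaussianReal 0 ((m : NNReal))⁻¹) := memLp_id_gaussianReal 2
      exact this.const_mul _)
  have e : (fun x : Fin m → ℝ => ∑ τ, a τ * x τ) = ∑ τ, (fun x : Fin m → ℝ => a τ * x τ) := by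
    ext x; simp
  rw [e, h, Finset.sum_div]
  refine Finset.sum_congr rfl fun τ _ => ?_
  rw [variance_const_mul, variance_fun_id_gaussianReal]
  simp [div_eq_mul_inv]

lemma linY_var {p m : ℕ} (a : Fin p → Fin m → ℝ) :
    Var[linY a; gaussMeasure p m] = (∑ i, ∑ τ, a i τ ^ 2) / m := by
  have h := variance_sum_pi (μ := fun _ : Fin p => Measure.pi fun _ : Fin m => gaussianReal 0 ((m : NNReal))⁻¹)
    (X := fun i x => ∑ τ, a i τ * x τ) (fun i => by
      refine memLp_finsetSum _ fun τ _ => ?_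
      have : MemLp (fun x : ℝ => x) 2 (gaussianReal 0 ((m : NNReal))⁻¹) := memLp_id_gaussianReal 2
      have h2 := this.comp_measurePreserving
        (measurePreserving_eval (fun _ : Fin m => gaussianReal 0 ((m : NNReal))⁻¹) τ)
      exact h2.const_mul _)
  have e : (linY a) = ∑ i, (fun x : Fin p → Fin m → ℝ => ∑ τ, a i τ * x i τ) := by
    ext x; simp [linY]
  rw [e, gaussMeasure, h, Finset.sum_div]
  exact Finset.sum_congr rfl fun i _ => var_inner _

lemma linY_mean {p m : ℕ} (a : Fin p → Fin m → ℝ) :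
    ∫ φ, linY a φ ∂(gaussMeasure p m) = 0 := by
  have hc : ∀ i τ, Integrable (fun φ : Fin p → Fin m → ℝ => φ i τ) (gaussMeasure p m) := by
    intro i τ
    have := (gm_gauss p m).map ((ContinuousLinearMap.proj τ : (Fin m → ℝ) →L[ℝ] ℝ).comp
      (ContinuousLinearMap.proj i : (Fin p → Fin m → ℝ) →L[ℝ] (Fin m → ℝ)))
    exact this.integrable
  have h0 : ∀ i τ, ∫ φ, φ i τ ∂(gaussMeasure p m) = 0 := by
    intro i τ
    have h1 := measurePreserving_eval (fun _ : Fin p => Measure.pi fun _ : Fin m => gaussianReal 0 ((m : NNReal))⁻¹) i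
    have h2 := measurePreserving_eval (fun _ : Fin m => gaussianReal 0 ((m : NNReal))⁻¹) τ
    have h3 := h2.comp h1
    have h4 : ∫ x, x ∂(gaussianReal 0 ((m : NNReal))⁻¹) = 0 := integral_id_gaussianReal
    rw [← h3.map_eq, integral_map h3.measurable.aemeasurable (by fun_prop)] at h4
    exact h4
  unfold linY
  rw [integral_finsetSum _ (fun i _ => integrable_finsetSum _ fun τ _ => (hc i τ).const_mul _)]
  refine Finset.sum_eq_zero fun i _ => ?_
  rw [integral_finsetSum _ (fun τ _ => (hc i τ).const_mul _)]
  refine Finset.sum_eq_zero fun τ _ => ?_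
  rw [integral_const_mul, h0, mul_zero]

lemma linY_map {p m : ℕ} (a : Fin p → Fin m → ℝ) :
    (gaussMeasure p m).map (linY a) = gaussianReal 0 ((∑ i, ∑ τ, a i τ ^ 2) / m).toNNReal := by
  rw [(linY_gauss1 a).map_eq_gaussianReal, linY_mean, linY_var]

lemma linY_cov {p m : ℕ} (a b : Fin p → Fin m → ℝ) (h : ∑ i, ∑ τ, a i τ * b i τ = 0) :
    cov[linY a, linY b; gaussMeasure p m] = 0 := by
  have h1 := variance_add (linY_memLp (p := p) (m := m) a) (linY_memLp b)
  have e : linY a + linY b = linY (a + b) := by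
    ext x; simp [linY, add_mul, Finset.sum_add_distrib]
  rw [e, linY_var, linY_var, linY_var] at h1
  have e2 : ∑ i, ∑ τ, (a + b) i τ ^ 2 = (∑ i, ∑ τ, a i τ ^ 2) + 2 * (∑ i, ∑ τ, a i τ * b i τ)
      + ∑ i, ∑ τ, b i τ ^ 2 := by
    simp only [Pi.add_apply, add_sq, Finset.sum_add_distrib, Finset.mul_sum, mul_assoc]
  rw [e2, h] at h1
  simp only [mul_zero, add_zero, add_div] at h1
  linarith

lemma linY_indep {p m : ℕ} {ι : Type*} [Fintype ι] (a : ι → Fin p → Fin m → ℝ)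
    (h : ∀ u v, u ≠ v → ∑ i, ∑ τ, a u i τ * a v i τ = 0) :
    iIndepFun (fun w => linY (a w)) (gaussMeasure p m) := by
  refine (linY_gauss a).iIndepFun_of_covariance_eq_zero fun u v huv => linY_cov _ _ (h u v huv)
lemma linY_meas {p m : ℕ} (a : Fin p → Fin m → ℝ) : Measurable (linY a) := by
  unfold linY; fun_prop

lemma linY_tail {p m : ℕ} (a : Fin p → Fin m → ℝ) (ha : (∑ i, ∑ τ, a i τ ^ 2) / m ≤ 1)
    {u : ℝ} (hu : 0 ≤ u) :
    (gaussMeasure p m).real {φ | u ≤ linY a φ} ≤ Real.exp (- u ^ 2 / 2) := by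
  have h : HasSubgaussianMGF (linY a) 1 (gaussMeasure p m) := by
    refine ⟨fun t => ?_, fun t => ?_⟩
    · have h1 : Integrable (fun x => Real.exp (t * x)) ((gaussMeasure p m).map (linY a)) := by
        rw [linY_map]; exact integrable_exp_mul_gaussianReal t
      exact h1.comp_measurable (linY_meas a)
    · rw [mgf_gaussianReal (linY_map a)]
      apply Real.exp_le_exp.2
      have : (((∑ i, ∑ τ, a i τ ^ 2) / m).toNNReal : ℝ) ≤ 1 := by
        rw [Real.coe_toNNReal']; exact max_le ha zero_le_one
      simp only [zero_mul, zero_add, NNReal.coe_one]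
      nlinarith [sq_nonneg t]
  have := h.measure_ge_le hu
  simpa using this

lemma linY_neg {p m : ℕ} (a : Fin p → Fin m → ℝ) (φ) : linY (-a) φ = - linY a φ := by
  simp [linY]

lemma linY_tail_abs {p m : ℕ} (a : Fin p → Fin m → ℝ) (ha : (∑ i, ∑ τ, a i τ ^ 2) / m ≤ 1)
    {u : ℝ} (hu : 0 ≤ u) :
    (gaussMeasure p m).real {φ | u ≤ |linY a φ|} ≤ 2 * Real.exp (- u ^ 2 / 2) := by
  have h1 := linY_tail a ha hu
  have h2 := linY_tail (-a) (by simpa using ha) hu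
  have h3 : {φ | u ≤ |linY a φ|} ⊆ {φ | u ≤ linY a φ} ∪ {φ | u ≤ linY (-a) φ} := by
    intro φ hφ
    simp only [Set.mem_ofPred_eq, Set.mem_union, linY_neg] at *
    exact le_abs.1 hφ
  calc _ ≤ (gaussMeasure p m).real ({φ | u ≤ linY a φ} ∪ {φ | u ≤ linY (-a) φ}) := measureReal_mono h3
    _ ≤ _ := measureReal_union_le _ _
    _ ≤ _ := by linarith

lemma gauss_small {v : NNReal} {σ : ℝ} (hσ : 0 < σ) (hv : σ ^ 2 ≤ v) {b : ℝ} (hb : 0 ≤ b) :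
    (gaussianReal 0 v).real {x | |x| < b} ≤ b / σ := by
  have hv0 : v ≠ 0 := by
    rintro rfl
    simp at hv; nlinarith
  have hm : MeasurableSet {x : ℝ | |x| < b} := measurableSet_lt (by fun_prop) (by fun_prop)
  have hset : {x : ℝ | |x| < b} = Set.Ioo (-b) b := by ext x; simp [abs_lt]
  have hvpos : (0 : ℝ) < v := lt_of_lt_of_le (by positivity) hv
  rw [measureReal_def, gaussianReal_apply_eq_integral _ hv0, ENNReal.toReal_ofReal
    (integral_nonneg fun x => gaussianPDFReal_nonneg _ _ _)]
  have hle : ∀ x, gaussianPDFReal 0 v x ≤ 1 / (2 * σ) := by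
    intro x
    rw [gaussianPDFReal]
    have h1 : Real.exp (-(x - 0) ^ 2 / (2 * v)) ≤ 1 := by
      rw [Real.exp_le_one_iff]
      apply div_nonpos_of_nonpos_of_nonneg
      · nlinarith [sq_nonneg (x - 0)]
      · positivity
    have h2 : 2 * σ ≤ Real.sqrt (2 * Real.pi * v) := by
      apply Real.le_sqrt_of_sq_le
      nlinarith [Real.pi_gt_three, sq_nonneg σ]
    calc _ ≤ (Real.sqrt (2 * Real.pi * v))⁻¹ * 1 := by gcongr
      _ ≤ (2 * σ)⁻¹ := by rw [mul_one]; gcongr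
      _ = _ := by rw [one_div]
  calc _ ≤ ∫ x in {x : ℝ | |x| < b}, (1 / (2 * σ)) := by
        apply setIntegral_mono_on
        · exact (integrable_gaussianPDFReal 0 v).integrableOn
        · rw [hset]; exact integrableOn_const (by simp)
        · exact hm
        · intro x _; exact hle x
    _ = b / σ := by
        rw [setIntegral_const, hset]
        simp only [measureReal_def, Real.volume_Ioo, smul_eq_mul]
        rw [ENNReal.toReal_ofReal (by linarith)]
        field_simp; ring

lemma small_ball_count {p m : ℕ} {ι : Type*} [Fintype ι] (a : ι → Fin p → Fin m → ℝ)
    (h : ∀ u v, u ≠ v → ∑ i, ∑ τ, a u i τ * a v i τ = 0) {σ : ℝ} (hσ : 0 < σ)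
    (hv : ∀ u, σ ^ 2 ≤ (∑ i, ∑ τ, a u i τ ^ 2) / m) :
    (gaussMeasure p m).real {φ | (Fintype.card ι : ℝ) / 2 ≤
      ∑ w, Set.indicator {x : ℝ | |x| < σ / 100} 1 (linY (a w) φ)} ≤ Real.exp (- (Fintype.card ι : ℝ)) := by
  have hm : MeasurableSet {x : ℝ | |x| < σ / 100} := measurableSet_lt (by fun_prop) (by fun_prop)
  set f : ℝ → ℝ := Set.indicator {x : ℝ | |x| < σ / 100} 1 with hf
  have hfm : Measurable f := measurable_one.indicator hm
  have hf01 : ∀ x, f x = 0 ∨ f x = 1 := by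
    intro x; by_cases hx : x ∈ {x : ℝ | |x| < σ / 100}
    · right; simp only [hf, Set.indicator_of_mem hx, Pi.one_apply]
    · left; simp only [hf, Set.indicator_of_notMem hx]
  have hind : iIndepFun (fun w => f ∘ linY (a w)) (gaussMeasure p m) :=
    (linY_indep a h).comp _ (fun _ => hfm)
  have hmeas : ∀ w, Measurable (f ∘ linY (a w)) := fun w => hfm.comp (linY_meas _)
  have hexp : Real.exp 4 ≤ 60 := by
    have h2 := Real.exp_one_lt_d9
    have : Real.exp 4 = Real.exp 1 ^ 4 := by rw [← Real.exp_nat_mul]; norm_num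
    rw [this]
    calc Real.exp 1 ^ 4 ≤ (2.7182818286 : ℝ) ^ 4 := by
          gcongr
      _ ≤ 60 := by norm_num
  have hpt : ∀ w, ∀ φ, Real.exp (4 * (f ∘ linY (a w)) φ) = 1 + (Real.exp 4 - 1) * f (linY (a w) φ) := by
    intro w φ
    rcases hf01 (linY (a w) φ) with h0 | h0 <;> simp [h0]
  have hint : ∀ w, Integrable (fun φ => f (linY (a w) φ)) (gaussMeasure p m) := by
    intro w
    refine Integrable.of_bound (hmeas w).aestronglyMeasurable 1 (.of_forall fun φ => ?_)
    rcases hf01 (linY (a w) φ) with h0 | h0 <;> simp [h0]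
  have hmgf : ∀ w, mgf (f ∘ linY (a w)) (gaussMeasure p m) 4 ≤ 2 := by
    intro w
    rw [mgf]
    simp_rw [hpt]
    rw [integral_add (integrable_const _) ((hint w).const_mul _), integral_const_mul]
    have h1 : ∫ φ, f (linY (a w) φ) ∂(gaussMeasure p m) ≤ 1 / 100 := by
      have h2 : ∫ φ, f (linY (a w) φ) ∂(gaussMeasure p m) = ∫ x, f x ∂((gaussMeasure p m).map (linY (a w))) := by
        rw [integral_map (linY_meas _).aemeasurable hfm.aestronglyMeasurable]
      rw [h2, linY_map, hf, integral_indicator_one hm]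
      refine (gauss_small hσ ?_ (by positivity)).trans (le_of_eq (by field_simp))
      exact (hv w).trans (Real.le_coe_toNNReal _)
    simp only [integral_const, probReal_univ, smul_eq_mul, one_mul]
    have h3 : (0 : ℝ) ≤ Real.exp 4 - 1 := by linarith [Real.add_one_le_exp (4 : ℝ)]
    nlinarith
  have hmg2 : mgf (∑ w, f ∘ linY (a w)) (gaussMeasure p m) 4 ≤ 2 ^ (Fintype.card ι) := by
    rw [hind.mgf_sum (fun w => (hmeas w)) Finset.univ]
    calc _ ≤ ∏ w : ι, (2 : ℝ) := Finset.prod_le_prod (fun _ _ => mgf_nonneg) (fun w _ => hmgf w)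
      _ = _ := by simp
  have hch := measure_ge_le_exp_mul_mgf (μ := gaussMeasure p m) (X := ∑ w, f ∘ linY (a w))
    (t := 4) ((Fintype.card ι : ℝ) / 2) (by norm_num) (by
      refine Integrable.of_bound (C := Real.exp (4 * Fintype.card ι)) ?_ (.of_forall fun φ => ?_)
      · refine (Measurable.exp (Measurable.const_mul ?_ _)).aestronglyMeasurable
        have h9 := Finset.measurable_sum (Finset.univ : Finset ι) (fun w _ => hmeas w)
        convert h9 using 1
        ext φ; simp
      · rw [Real.norm_eq_abs, Real.abs_exp]
        apply Real.exp_le_exp.2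
        gcongr
        rw [Finset.sum_apply]
        calc _ ≤ ∑ w : ι, (1 : ℝ) := Finset.sum_le_sum fun w _ => by
              rcases hf01 (linY (a w) φ) with h0 | h0 <;> simp [h0]
          _ = _ := by simp)
  have hset : {φ | (Fintype.card ι : ℝ) / 2 ≤ ∑ w, f (linY (a w) φ)} =
      {φ | (Fintype.card ι : ℝ) / 2 ≤ (∑ w, f ∘ linY (a w)) φ} := by
    ext φ; simp [Finset.sum_apply]
  rw [hset]
  refine hch.trans ?_
  have h2e : (2 : ℝ) ^ (Fintype.card ι) ≤ Real.exp (Fintype.card ι) := by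
    rw [← mul_one (Fintype.card ι : ℝ), Real.exp_nat_mul]
    gcongr
    linarith [Real.add_one_le_exp (1 : ℝ)]
  calc _ ≤ Real.exp (-4 * ((Fintype.card ι : ℝ) / 2)) * Real.exp (Fintype.card ι) := by
        gcongr; exact hmg2.trans h2e
    _ = _ := by rw [← Real.exp_add]; congr 1; ring
lemma cos_sum_zero (m : ℕ) (d : ℤ) (h : ¬ (m : ℤ) ∣ d) (a : ℝ) :
    ∑ τ ∈ Finset.range m, Real.cos (2 * Real.pi * d / m * τ + a) = 0 := by
  rcases Nat.eq_zero_or_pos m with rfl | hm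
  · simp
  have hm' : (m : ℂ) ≠ 0 := by exact_mod_cast hm.ne'
  set ζ : ℂ := Complex.exp (2 * Real.pi * d / m * Complex.I) with hζ
  have h1 : ζ ^ m = 1 := by
    rw [hζ, ← Complex.exp_nat_mul, Complex.exp_eq_one_iff]
    exact ⟨d, by field_simp⟩
  have h2 : ζ ≠ 1 := by
    intro hh
    rw [hζ, Complex.exp_eq_one_iff] at hh
    obtain ⟨k, hk⟩ := hh
    apply h
    have hpi : (2 * Real.pi * Complex.I : ℂ) ≠ 0 := Complex.two_pi_I_ne_zero
    have h3 : (d : ℂ) = m * k := by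
      have : (2 * Real.pi * Complex.I : ℂ) * d = (2 * Real.pi * Complex.I) * (m * k) := by
        field_simp at hk
        linear_combination (2 * Real.pi * Complex.I : ℂ) * hk
      exact mul_left_cancel₀ hpi this
    exact ⟨k, by exact_mod_cast h3⟩
  have h3 : ∑ τ ∈ Finset.range m, ζ ^ τ = 0 := by
    have := geom_sum_mul ζ m
    rw [h1, sub_self] at this
    exact (mul_eq_zero.1 this).resolve_right (sub_ne_zero.2 h2)
  have h4 : ∀ τ : ℕ, Real.cos (2 * Real.pi * d / m * τ + a) = (Complex.exp (a * Complex.I) * ζ ^ τ).re := by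
    intro τ
    rw [hζ, ← Complex.exp_nat_mul, ← Complex.exp_add,
      show (a * Complex.I + τ * (2 * Real.pi * d / m * Complex.I) : ℂ)
        = ((2 * Real.pi * d / m * τ + a : ℝ) : ℂ) * Complex.I by push_cast; ring,
      Complex.exp_ofReal_mul_I_re]
  simp_rw [h4]
  rw [← Complex.re_sum, ← Finset.mul_sum, h3]
  simp

lemma sin_sum_zero (m : ℕ) (d : ℤ) (h : ¬ (m : ℤ) ∣ d) :
    ∑ τ ∈ Finset.range m, Real.sin (2 * Real.pi * d / m * τ) = 0 := by
  have := cos_sum_zero m d h (-(Real.pi / 2))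
  simpa [← sub_eq_add_neg, Real.cos_sub_pi_div_two] using this

lemma cos_sum_eq (m : ℕ) (hm : 0 < m) (d : ℤ) :
    ∑ ω ∈ Finset.range m, Real.cos (2 * Real.pi * ω / m * d) = if (m : ℤ) ∣ d then (m : ℝ) else 0 := by
  split_ifs with h
  · obtain ⟨q, rfl⟩ := h
    have hm' : (m : ℝ) ≠ 0 := by exact_mod_cast hm.ne'
    have : ∀ ω ∈ Finset.range m, Real.cos (2 * Real.pi * ω / m * ((m * q : ℤ) : ℝ)) = 1 := by
      intro ω _
      rw [Real.cos_eq_one_iff]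
      exact ⟨ω * q, by push_cast; field_simp⟩
    rw [Finset.sum_congr rfl this]; simp
  · rw [← cos_sum_zero m d h 0]
    refine Finset.sum_congr rfl fun ω _ => ?_
    congr 1; ring

section
variable {p n : ℕ}

noncomputable def cA (m ω : ℕ) (z : Fin p × Fin n → ℝ) (i : Fin p) : ℝ :=
  ∑ k : Fin n, z (i, k) * Real.cos (2 * Real.pi * ω / m * k)
noncomputable def cB (m ω : ℕ) (z : Fin p × Fin n → ℝ) (i : Fin p) : ℝ :=
  ∑ k : Fin n, z (i, k) * Real.sin (2 * Real.pi * ω / m * k)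

lemma wv_eq (m ω : ℕ) (z : Fin p × Fin n → ℝ) (i : Fin p) (τ : Fin m) :
    wv m ω z i τ = cA m ω z i * Real.cos (2 * Real.pi * ω / m * τ)
      - cB m ω z i * Real.sin (2 * Real.pi * ω / m * τ) := by
  simp only [wv, cA, cB, Finset.sum_mul, ← Finset.sum_sub_distrib]
  refine Finset.sum_congr rfl fun k _ => ?_
  rw [mul_add, Real.cos_add]; ring

lemma prod_sum (m : ℕ) (ω ω' : ℕ) (A B A' B' : ℝ) :
    ∑ τ ∈ Finset.range m, (A * Real.cos (2 * Real.pi * ω / m * τ) - B * Real.sin (2 * Real.pi * ω / m * τ)) *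
      (A' * Real.cos (2 * Real.pi * ω' / m * τ) - B' * Real.sin (2 * Real.pi * ω' / m * τ)) =
    1 / 2 * ((A * A' + B * B') * (∑ τ ∈ Finset.range m, Real.cos (2 * Real.pi * ((ω : ℤ) - ω' : ℤ) / m * τ))
      + (A * A' - B * B') * (∑ τ ∈ Finset.range m, Real.cos (2 * Real.pi * ((ω : ℤ) + ω' : ℤ) / m * τ))
      + (A * B' - B * A') * (∑ τ ∈ Finset.range m, Real.sin (2 * Real.pi * ((ω : ℤ) - ω' : ℤ) / m * τ))
      - (A * B' + B * A') * (∑ τ ∈ Finset.range m, Real.sin (2 * Real.pi * ((ω : ℤ) + ω' : ℤ) / m * τ))) := by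
  simp only [Finset.mul_sum, ← Finset.sum_add_distrib, ← Finset.sum_sub_distrib]
  refine Finset.sum_congr rfl fun τ _ => ?_
  have e1 : (2 * Real.pi * (((ω : ℤ) - ω' : ℤ) : ℝ) / m * τ) = 2 * Real.pi * ω / m * τ - 2 * Real.pi * ω' / m * τ := by
    push_cast; ring
  have e2 : (2 * Real.pi * (((ω : ℤ) + ω' : ℤ) : ℝ) / m * τ) = 2 * Real.pi * ω / m * τ + 2 * Real.pi * ω' / m * τ := by
    push_cast; ring
  rw [e1, e2, Real.cos_sub, Real.cos_add, Real.sin_sub, Real.sin_add]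
  ring

lemma cos_sum_zero' (m : ℕ) (d : ℤ) (h : ¬ (m : ℤ) ∣ d) :
    ∑ τ ∈ Finset.range m, Real.cos (2 * Real.pi * d / m * τ) = 0 := by
  simpa using cos_sum_zero m d h 0

lemma wv_orth (m ω ω' : ℕ) (hω : 2 * ω ≤ m) (hω' : 2 * ω' ≤ m) (hne : ω ≠ ω')
    (z : Fin p × Fin n → ℝ) : ∑ i, ∑ τ, wv m ω z i τ * wv m ω' z i τ = 0 := by
  refine Finset.sum_eq_zero fun i _ => ?_
  simp_rw [wv_eq]
  rw [Fin.sum_univ_eq_sum_range (fun τ : ℕ => (cA m ω z i * Real.cos (2 * Real.pi * ω / m * τ)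
      - cB m ω z i * Real.sin (2 * Real.pi * ω / m * τ)) * (cA m ω' z i * Real.cos (2 * Real.pi * ω' / m * τ)
      - cB m ω' z i * Real.sin (2 * Real.pi * ω' / m * τ))), prod_sum]
  have d1 : ¬ (m : ℤ) ∣ ((ω : ℤ) - ω') := by
    intro h
    have := Int.eq_zero_of_abs_lt_dvd h (abs_lt.2 ⟨by omega, by omega⟩)
    omega
  have d2 : ¬ (m : ℤ) ∣ ((ω : ℤ) + ω') := by
    intro h
    have := Int.eq_zero_of_abs_lt_dvd h (abs_lt.2 ⟨by omega, by omega⟩)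
    omega
  rw [cos_sum_zero' m _ d1, cos_sum_zero' m _ d2, sin_sum_zero m _ d1, sin_sum_zero m _ d2]
  ring

noncomputable def QQ (m ω : ℕ) (z : Fin p × Fin n → ℝ) : ℝ := ∑ i, (cA m ω z i ^ 2 + cB m ω z i ^ 2)

lemma SS_ge (m ω : ℕ) (hm : 0 < m) (z : Fin p × Fin n → ℝ) :
    QQ m ω z / 2 ≤ SS m ω z := by
  have hm' : (0 : ℝ) < m := by exact_mod_cast hm
  rw [SS, le_div_iff₀ hm', QQ, Finset.sum_div, Finset.sum_mul]
  refine Finset.sum_le_sum fun i _ => ?_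
  simp_rw [wv_eq, sq]
  rw [Fin.sum_univ_eq_sum_range (fun τ : ℕ => (cA m ω z i * Real.cos (2 * Real.pi * ω / m * τ)
      - cB m ω z i * Real.sin (2 * Real.pi * ω / m * τ)) * (cA m ω z i * Real.cos (2 * Real.pi * ω / m * τ)
      - cB m ω z i * Real.sin (2 * Real.pi * ω / m * τ)))]
  by_cases hd : (m : ℤ) ∣ ((ω : ℤ) + ω)
  · obtain ⟨q, hq⟩ := hd
    have hq' : (2 * ω : ℝ) = m * q := by
      have : (((ω : ℤ) + ω : ℤ) : ℝ) = ((m * q : ℤ) : ℝ) := by rw [hq]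
      push_cast at this; linarith
    have hs : ∀ k : ℕ, Real.sin (2 * Real.pi * ω / m * k) = 0 := by
      intro k
      rw [show 2 * Real.pi * ω / m * k = ((q * k : ℤ) : ℝ) * Real.pi by
        push_cast; field_simp; linear_combination (k : ℝ) * hq']
      exact Real.sin_int_mul_pi _
    have hB : cB m ω z i = 0 := by
      unfold cB; exact Finset.sum_eq_zero fun k _ => by rw [hs k, mul_zero]
    have hc : ∀ k : ℕ, Real.cos (2 * Real.pi * ω / m * k) * Real.cos (2 * Real.pi * ω / m * k) = 1 := by
      intro k
      have := Real.sin_sq_add_cos_sq (2 * Real.pi * ω / m * k)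
      rw [hs k] at this; nlinarith
    rw [hB]
    have : ∀ τ ∈ Finset.range m, (cA m ω z i * Real.cos (2 * Real.pi * ω / m * τ)
      - 0 * Real.sin (2 * Real.pi * ω / m * τ)) * (cA m ω z i * Real.cos (2 * Real.pi * ω / m * τ)
      - 0 * Real.sin (2 * Real.pi * ω / m * τ)) = cA m ω z i * cA m ω z i := by
      intro τ _
      linear_combination (cA m ω z i * cA m ω z i) * hc τ
    rw [Finset.sum_congr rfl this]
    simp only [Finset.sum_const, Finset.card_range, nsmul_eq_mul]
    nlinarith [mul_self_nonneg (cA m ω z i), mul_nonneg hm'.le (mul_self_nonneg (cA m ω z i))]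
  · rw [prod_sum, cos_sum_zero' m _ hd, sin_sum_zero m _ hd]
    simp
    apply le_of_eq; ring

lemma quad_cos {κ : Type*} (s : Finset κ) (m : ℕ) (hm : 0 < m) (v : κ → ℝ) (g : κ → ℕ) :
    ∑ ω ∈ Finset.range m, ((∑ j ∈ s, v j * Real.cos (2 * Real.pi * ω / m * g j)) ^ 2
      + (∑ j ∈ s, v j * Real.sin (2 * Real.pi * ω / m * g j)) ^ 2)
     = ∑ j ∈ s, ∑ l ∈ s, v j * v l * (if (m : ℤ) ∣ ((g j : ℤ) - g l) then (m : ℝ) else 0) := by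
  have : ∀ ω ∈ Finset.range m, ((∑ j ∈ s, v j * Real.cos (2 * Real.pi * ω / m * g j)) ^ 2
      + (∑ j ∈ s, v j * Real.sin (2 * Real.pi * ω / m * g j)) ^ 2)
      = ∑ j ∈ s, ∑ l ∈ s, v j * v l * Real.cos (2 * Real.pi * ω / m * ((g j - g l : ℤ) : ℝ)) := by
    intro ω _
    rw [sq, sq, Finset.sum_mul_sum, Finset.sum_mul_sum, ← Finset.sum_add_distrib]
    refine Finset.sum_congr rfl fun j _ => ?_
    rw [← Finset.sum_add_distrib]
    refine Finset.sum_congr rfl fun l _ => ?_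
    push_cast
    rw [mul_sub, Real.cos_sub]; ring
  rw [Finset.sum_congr rfl this, Finset.sum_comm]
  refine Finset.sum_congr rfl fun j _ => ?_
  rw [Finset.sum_comm]
  refine Finset.sum_congr rfl fun l _ => ?_
  rw [← Finset.mul_sum, cos_sum_eq m hm]

lemma QQ_sum (m : ℕ) (hm : 0 < m) (hn : n ≤ m) (z : Fin p × Fin n → ℝ) :
    ∑ ω ∈ Finset.range m, QQ m ω z = m * ∑ a, z a ^ 2 := by
  simp only [QQ]
  rw [Finset.sum_comm, Fintype.sum_prod_type, Finset.mul_sum]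
  refine Finset.sum_congr rfl fun i _ => ?_
  simp only [cA, cB]
  rw [quad_cos Finset.univ m hm (fun k => z (i, k)) (fun k => (k : ℕ)), Finset.mul_sum]
  refine Finset.sum_congr rfl fun k _ => ?_
  rw [Finset.sum_eq_single k]
  · simp; ring
  · intro l _ hl
    rw [if_neg, mul_zero]
    rintro ⟨q, hq⟩
    have h1 := k.2; have h2 := l.2
    rcases lt_trichotomy q 0 with h | h | h
    · nlinarith
    · subst h; apply hl; ext; omega
    · nlinarith
  · simp

lemma QQ_refl (m ω : ℕ) (hm : 0 < m) (h : ω ≤ m) (z : Fin p × Fin n → ℝ) : QQ m (m - ω) z = QQ m ω z := by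
  have hm' : (m : ℝ) ≠ 0 := by exact_mod_cast hm.ne'
  have e : ∀ k : ℕ, 2 * Real.pi * ((m - ω : ℕ) : ℝ) / m * k = (k : ℕ) * (2 * Real.pi) - 2 * Real.pi * ω / m * k := by
    intro k; push_cast [h]; field_simp
  unfold QQ cA cB
  refine Finset.sum_congr rfl fun i _ => ?_
  simp only [e, Real.cos_nat_mul_two_pi_sub, Real.sin_nat_mul_two_pi_sub, mul_neg, Finset.sum_neg_distrib, neg_sq]

lemma QQ_nonneg (m ω : ℕ) (z : Fin p × Fin n → ℝ) : 0 ≤ QQ m ω z :=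
  Finset.sum_nonneg fun _ _ => by positivity

lemma SS_sum (m : ℕ) (hm : 0 < m) (hn : n ≤ m) (z : Fin p × Fin n → ℝ) :
    m / 4 * ∑ a, z a ^ 2 ≤ ∑ ω ∈ Finset.range (m / 2 + 1), SS m ω z := by
  have h1 := QQ_sum m hm hn z
  have h2 : ∑ ω ∈ Finset.range m, QQ m ω z ≤ 2 * ∑ ω ∈ Finset.range (m / 2 + 1), QQ m ω z := by
    have h3 : ∑ ω ∈ Finset.Ico (m / 2 + 1) m, QQ m ω z ≤ ∑ ω ∈ Finset.range (m / 2 + 1), QQ m ω z := by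
      have h5 : ∑ ω ∈ Finset.Ico (m / 2 + 1) m, QQ m ω z =
          ∑ ω ∈ (Finset.Ico (m / 2 + 1) m).image (fun ω => m - ω), QQ m ω z := by
        rw [Finset.sum_image]
        · refine Finset.sum_congr rfl fun ω hω => ?_
          rw [QQ_refl m ω hm (Finset.mem_Ico.1 hω).2.le]
        · intro a ha b hb hab
          simp only [Finset.coe_Ico, Set.mem_Ico] at ha hb hab
          omega
      rw [h5]
      refine Finset.sum_le_sum_of_subset_of_nonneg ?_ (fun _ _ _ => QQ_nonneg _ _ _)
      intro a ha
      simp only [Finset.mem_image, Finset.mem_Ico, Finset.mem_range] at *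
      omega
    have h4 : ∑ ω ∈ Finset.range m, QQ m ω z ≤ ∑ ω ∈ Finset.range (m / 2 + 1) ∪ Finset.Ico (m / 2 + 1) m, QQ m ω z := by
      refine Finset.sum_le_sum_of_subset_of_nonneg ?_ (fun _ _ _ => QQ_nonneg _ _ _)
      intro a ha
      simp only [Finset.mem_union, Finset.mem_Ico, Finset.mem_range] at *
      omega
    rw [Finset.sum_union] at h4
    · linarith
    · rw [Finset.disjoint_left]; intro a ha hb
      simp only [Finset.mem_Ico, Finset.mem_range] at *
      omega
  have h6 : ∑ ω ∈ Finset.range (m / 2 + 1), QQ m ω z / 2 ≤ ∑ ω ∈ Finset.range (m / 2 + 1), SS m ω z :=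
    Finset.sum_le_sum fun ω _ => SS_ge m ω hm z
  rw [← Finset.sum_div] at h6
  linarith

lemma shift_sum (m n k : ℕ) (hk : k < n) (g : ℕ → ℝ) (φ : Fin m → ℝ) :
    ∑ j : Fin (m + n - 1), g j * (if h : k ≤ (j : ℕ) ∧ (j : ℕ) - k < m then φ ⟨(j : ℕ) - k, h.2⟩ else 0)
      = ∑ τ : Fin m, g (τ + k) * φ τ := by
  symm
  refine Finset.sum_of_injOn (fun τ : Fin m => (⟨τ + k, by omega⟩ : Fin (m + n - 1))) ?_ ?_ ?_ ?_
  · intro a _ b _ hab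
    simp at hab; ext; omega
  · intro a _; simp
  · intro j _ hj
    rw [dif_neg, mul_zero]
    rintro ⟨h1, h2⟩
    apply hj
    exact ⟨⟨j - k, h2⟩, by simp, by ext; simp; omega⟩
  · intro τ _
    have : k ≤ (τ : ℕ) + k ∧ (τ : ℕ) + k - k < m := ⟨by omega, by omega⟩
    simp [this]

lemma YY_eq (m ω : ℕ) (z : Fin p × Fin n → ℝ) (φ : Fin p → Fin m → ℝ) :
    YY m ω z φ = ∑ j : Fin (m + n - 1), (linProbeMatrix p n m φ).mulVec z j *
      Real.cos (2 * Real.pi * ω / m * (j : ℕ)) := by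
  simp only [Matrix.mulVec, dotProduct, linProbeMatrix, Matrix.of_apply, Finset.sum_mul]
  rw [Finset.sum_comm, Fintype.sum_prod_type]
  unfold YY linY wv
  refine Finset.sum_congr rfl fun i _ => ?_
  simp_rw [Finset.sum_mul]
  rw [Finset.sum_comm]
  refine Finset.sum_congr rfl fun k _ => ?_
  have := shift_sum m n k k.2 (fun j => z (i, k) * Real.cos (2 * Real.pi * ω / m * (j : ℕ))) (φ i)
  push_cast at this
  rw [← this]
  refine Finset.sum_congr rfl fun j _ => ?_
  ring

lemma YY_bessel (m : ℕ) (hm : 2 ≤ m) (hn : n ≤ m) (z : Fin p × Fin n → ℝ) (φ : Fin p → Fin m → ℝ) :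
    ∑ ω ∈ Finset.range (m / 2 + 1), YY m ω z φ ^ 2 ≤ 2 * m * ∑ j, (linProbeMatrix p n m φ).mulVec z j ^ 2 := by
  set v := (linProbeMatrix p n m φ).mulVec z with hv
  have h1 : ∑ ω ∈ Finset.range (m / 2 + 1), YY m ω z φ ^ 2 ≤
      ∑ ω ∈ Finset.range m, ((∑ j, v j * Real.cos (2 * Real.pi * ω / m * (j : ℕ))) ^ 2
      + (∑ j, v j * Real.sin (2 * Real.pi * ω / m * (j : ℕ))) ^ 2) := by
    refine (Finset.sum_le_sum fun ω _ => ?_).trans (Finset.sum_le_sum_of_subset_of_nonneg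
      (Finset.range_mono (by omega : m / 2 + 1 ≤ m)) (fun _ _ _ => by positivity))
    rw [YY_eq]
    exact le_add_of_nonneg_right (sq_nonneg _)
  rw [quad_cos Finset.univ m (by omega) v (fun j => (j : ℕ))] at h1
  refine h1.trans ?_
  have hcard : ∀ j : Fin (m + n - 1), ∑ l : Fin (m + n - 1),
      (if (m : ℤ) ∣ (((j : ℕ) : ℤ) - (l : ℕ)) then (m : ℝ) else 0) ≤ 2 * m := by
    intro j
    rw [← Finset.sum_filter, Finset.sum_const, nsmul_eq_mul]
    gcongr
    have : (Finset.univ.filter fun l : Fin (m + n - 1) => (m : ℤ) ∣ (((j : ℕ) : ℤ) - (l : ℕ))).card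
        ≤ (Finset.range 2).card := by
      refine Finset.card_le_card_of_injOn (fun l => (l : ℕ) / m) ?_ ?_
      · intro l _
        simp only [Finset.coe_range, Set.mem_Iio]
        rw [Nat.div_lt_iff_lt_mul (by omega)]
        have := l.2; omega
      · intro a ha b hb hab
        simp only [Finset.coe_filter, Finset.mem_univ, true_and, Set.mem_ofPred_eq] at ha hb hab
        have h3 : (m : ℤ) ∣ ((a : ℕ) : ℤ) - (b : ℕ) := by
          have := dvd_sub hb ha
          rwa [sub_sub_sub_cancel_left] at this
        have h4 := Nat.div_add_mod a m
        have h5 := Nat.div_add_mod b m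
        have h6 := Nat.mod_lt (a : ℕ) (by omega : m > 0)
        have h7 := Nat.mod_lt (b : ℕ) (by omega : m > 0)
        rw [hab] at h4
        have := Int.eq_zero_of_abs_lt_dvd h3 (abs_lt.2 ⟨by omega, by omega⟩)
        ext; omega
    exact_mod_cast this
  calc _ ≤ ∑ j : Fin (m + n - 1), ∑ l : Fin (m + n - 1), ((v j ^ 2 / 2) * (if (m : ℤ) ∣ (((j : ℕ) : ℤ) - (l : ℕ)) then (m : ℝ) else 0)
        + (v l ^ 2 / 2) * (if (m : ℤ) ∣ (((j : ℕ) : ℤ) - (l : ℕ)) then (m : ℝ) else 0)) := by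
        refine Finset.sum_le_sum fun j _ => Finset.sum_le_sum fun l _ => ?_
        rw [← add_mul]
        refine mul_le_mul_of_nonneg_right ?_ (by positivity)
        nlinarith [sq_nonneg (v j - v l)]
    _ = 2 * ∑ j : Fin (m + n - 1), ∑ l : Fin (m + n - 1), ((v j ^ 2 / 2) * (if (m : ℤ) ∣ (((j : ℕ) : ℤ) - (l : ℕ)) then (m : ℝ) else 0)) := by
        simp_rw [Finset.sum_add_distrib]
        rw [two_mul]
        congr 1
        rw [Finset.sum_comm]
        refine Finset.sum_congr rfl fun j _ => Finset.sum_congr rfl fun l _ => ?_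
        have : ((m : ℤ) ∣ (((l : ℕ) : ℤ) - (j : ℕ))) ↔ ((m : ℤ) ∣ (((j : ℕ) : ℤ) - (l : ℕ))) := dvd_sub_comm
        simp only [this]
    _ ≤ 2 * ∑ j, (v j ^ 2 / 2) * (2 * m) := by
        gcongr with j
        rw [← Finset.mul_sum]
        exact mul_le_mul_of_nonneg_left (hcard j) (by positivity)
    _ = _ := by rw [← Finset.sum_mul, ← Finset.sum_div]; ring
end
/-- one averaging step -/
lemma exists_le_avg {α : Type*} [Fintype α] (q : α → ℝ) (hq : ∀ a, 0 ≤ q a) (hq1 : ∑ a, q a = 1)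
    (F : α → ℝ) (c : ℝ) (h : ∑ a, q a * F a ≤ c) : ∃ a, F a ≤ c := by
  by_contra! hh
  have : ∑ a, q a * c < ∑ a, q a * F a := by
    refine Finset.sum_lt_sum (fun a _ => mul_le_mul_of_nonneg_left (hh a).le (hq a)) ?_
    by_contra! h0
    have : ∀ a, q a = 0 := by
      intro a
      by_contra h1
      have := h0 a (Finset.mem_univ a)
      have h2 : 0 < q a := lt_of_le_of_ne (hq a) (Ne.symm h1)
      nlinarith [hh a]
    simp [this] at hq1
  rw [← Finset.sum_mul, hq1] at this
  linarith

lemma maurey_abs {α W B : Type*} [Fintype α] (HW : Finset W) (HB : Finset B)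
    (q : α → ℝ) (hq : ∀ a, 0 ≤ q a) (hq1 : ∑ a, q a = 1)
    (y : W → α → ℝ) (x : B → α → ℝ)
    (hy : ∀ w ∈ HW, ∑ a, q a * y w a = 0) (hx : ∀ b ∈ HB, ∑ a, q a * x b a = 0)
    (β V lam : ℝ) (hβ : 0 < β) (hV : 0 < V)
    (hyB : ∀ w ∈ HW, ∀ a, |y w a| ≤ β) (hxV : ∀ a, ∑ b ∈ HB, x b a ^ 2 ≤ V)
    (M : ℝ) (hM : 0 < M) (hMc : (HW.card : ℝ) ≤ M) (N : ℕ) (hN : 0 < N) :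
    ∃ f : Fin N → α, (∀ w ∈ HW, Real.cosh (lam * ∑ l, y w (f l)) ≤ 2 * M * Real.exp (lam ^ 2 * β ^ 2 / 2) ^ N)
      ∧ ∑ b ∈ HB, (∑ l, x b (f l)) ^ 2 ≤ 2 * N * V := by
  set E := Real.exp (lam ^ 2 * β ^ 2 / 2) with hE
  have hEpos : 0 < E := Real.exp_pos _
  have key : ∀ k : ℕ, ∃ f : Fin k → α,
      (∑ w ∈ HW, Real.cosh (lam * ∑ l, y w (f l))) / (M * E ^ k) +
       ((∑ b ∈ HB, (∑ l, x b (f l)) ^ 2) - k * V) / (N * V) ≤ 1 := by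
    intro k
    induction k with
    | zero =>
      refine ⟨Fin.elim0, ?_⟩
      simp
      rw [div_le_one hM]; exact hMc
    | succ k ih =>
      obtain ⟨f, hf⟩ := ih
      have hc : ∀ w ∈ HW, ∑ a, q a * Real.cosh (lam * (∑ l, y w (f l) + y w a)) ≤
          E * Real.cosh (lam * ∑ l, y w (f l)) := by
        intro w hw
        set D := ∑ l, y w (f l) with hD
        have e1 : ∀ a, q a * Real.cosh (lam * (D + y w a)) ≤
            Real.cosh (lam * β) * Real.cosh (lam * D) * q a
             + (Real.sinh (lam * β) * Real.sinh (lam * D) / β) * (q a * y w a) := by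
          intro a
          have ht : |y w a / β| ≤ 1 := by
            rw [abs_div, abs_of_pos hβ, div_le_one hβ]; exact hyB w hw a
          have h1 := Real.exp_mul_le_cosh_add_mul_sinh ht (lam * β)
          have h2 := Real.exp_mul_le_cosh_add_mul_sinh ht (-(lam * β))
          rw [Real.cosh_neg, Real.sinh_neg] at h2
          rw [show y w a / β * (lam * β) = lam * y w a by field_simp] at h1
          rw [show y w a / β * -(lam * β) = -(lam * y w a) by field_simp] at h2
          have h3 : Real.cosh (lam * (D + y w a)) =
              (Real.exp (lam * D) * Real.exp (lam * y w a) + Real.exp (-(lam * D)) * Real.exp (-(lam * y w a))) / 2 := by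
            rw [Real.cosh_eq, ← Real.exp_add, ← Real.exp_add]; ring_nf
          have h4 : Real.cosh (lam * (D + y w a)) ≤ Real.cosh (lam * β) * Real.cosh (lam * D)
              + (Real.sinh (lam * β) * Real.sinh (lam * D) / β) * y w a := by
            rw [h3]
            have h5 := mul_le_mul_of_nonneg_left h1 (Real.exp_pos (lam * D)).le
            have h6 := mul_le_mul_of_nonneg_left h2 (Real.exp_pos (-(lam * D))).le
            have h7 : (Real.sinh (lam * β) * Real.sinh (lam * D) / β) * y w a
              = (y w a / β) * Real.sinh (lam * β) * Real.sinh (lam * D) := by ring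
            rw [h7, Real.cosh_eq (lam * D), Real.sinh_eq (lam * D)]
            linarith
          have := mul_le_mul_of_nonneg_left h4 (hq a)
          linarith
        calc _ ≤ _ := Finset.sum_le_sum fun a _ => e1 a
          _ = Real.cosh (lam * β) * Real.cosh (lam * D) := by
            rw [Finset.sum_add_distrib, ← Finset.mul_sum, ← Finset.mul_sum, hq1, hy w hw]; ring
          _ ≤ _ := by
            refine mul_le_mul_of_nonneg_right ?_ (Real.cosh_pos _).le
            refine (Real.cosh_le_exp_half_sq _).trans (Real.exp_le_exp.2 (le_of_eq ?_))
            ring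
      have hs : ∑ a, q a * ∑ b ∈ HB, (∑ l, x b (f l) + x b a) ^ 2 ≤
          ∑ b ∈ HB, (∑ l, x b (f l)) ^ 2 + V := by
        have e1 : ∀ a, q a * ∑ b ∈ HB, (∑ l, x b (f l) + x b a) ^ 2 =
           q a * ∑ b ∈ HB, (∑ l, x b (f l)) ^ 2 + ∑ b ∈ HB, 2 * (∑ l, x b (f l)) * (q a * x b a)
            + q a * ∑ b ∈ HB, x b a ^ 2 := by
          intro a
          simp only [Finset.mul_sum, ← Finset.sum_add_distrib]
          refine Finset.sum_congr rfl fun b _ => ?_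
          simp only [← Finset.mul_sum]
          ring
        simp_rw [e1]
        rw [Finset.sum_add_distrib, Finset.sum_add_distrib, ← Finset.sum_mul, hq1, one_mul]
        have e2 : ∑ a, ∑ b ∈ HB, 2 * (∑ l, x b (f l)) * (q a * x b a) = 0 := by
          rw [Finset.sum_comm]
          refine Finset.sum_eq_zero fun b hb => ?_
          rw [← Finset.mul_sum, hx b hb, mul_zero]
        have e3 : ∑ a, q a * ∑ b ∈ HB, x b a ^ 2 ≤ V := by
          calc _ ≤ ∑ a, q a * V := Finset.sum_le_sum fun a _ => mul_le_mul_of_nonneg_left (hxV a) (hq a)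
            _ = V := by rw [← Finset.sum_mul, hq1, one_mul]
        linarith
      obtain ⟨a, ha⟩ := exists_le_avg q hq hq1 (fun a =>
        (∑ w ∈ HW, Real.cosh (lam * (∑ l, y w (f l) + y w a))) / (M * E ^ (k + 1)) +
        ((∑ b ∈ HB, (∑ l, x b (f l) + x b a) ^ 2) - ((k + 1 : ℕ) : ℝ) * V) / (N * V)) 1 (by
          have e : ∑ a, q a * ((∑ w ∈ HW, Real.cosh (lam * (∑ l, y w (f l) + y w a))) / (M * E ^ (k + 1)) +
              ((∑ b ∈ HB, (∑ l, x b (f l) + x b a) ^ 2) - ((k + 1 : ℕ) : ℝ) * V) / (N * V))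
              = (∑ w ∈ HW, ∑ a, q a * Real.cosh (lam * (∑ l, y w (f l) + y w a))) / (M * E ^ (k + 1))
                + ((∑ a, q a * ∑ b ∈ HB, (∑ l, x b (f l) + x b a) ^ 2) - ((k + 1 : ℕ) : ℝ) * V) / (N * V) := by
            rw [Finset.sum_comm]
            simp only [mul_add, Finset.sum_add_distrib, mul_div_assoc', ← Finset.sum_div, mul_sub,
              Finset.sum_sub_distrib, ← Finset.mul_sum, ← Finset.sum_mul, hq1, one_mul]
          rw [e]
          refine le_trans ?_ hf
          have h1 : (∑ w ∈ HW, ∑ a, q a * Real.cosh (lam * (∑ l, y w (f l) + y w a)))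
              ≤ E * ∑ w ∈ HW, Real.cosh (lam * ∑ l, y w (f l)) := by
            rw [Finset.mul_sum]; exact Finset.sum_le_sum hc
          have h2 : (∑ w ∈ HW, Real.cosh (lam * ∑ l, y w (f l))) / (M * E ^ k)
              = (E * ∑ w ∈ HW, Real.cosh (lam * ∑ l, y w (f l))) / (M * E ^ (k + 1)) := by
            field_simp; ring
          rw [h2]
          have hNV : 0 < (N : ℝ) * V := by positivity
          refine add_le_add (div_le_div_of_nonneg_right h1 (by positivity)) (div_le_div_of_nonneg_right ?_ hNV.le)
          push_cast
          linarith)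
      refine ⟨Fin.snoc f a, ?_⟩
      simpa [Fin.sum_univ_castSucc] using ha
  obtain ⟨f, hf⟩ := key N
  have hN' : (0 : ℝ) < N := by exact_mod_cast hN
  have hpos1 : 0 ≤ (∑ w ∈ HW, Real.cosh (lam * ∑ l, y w (f l))) / (M * E ^ N) := by
    have : 0 ≤ ∑ w ∈ HW, Real.cosh (lam * ∑ l, y w (f l)) := Finset.sum_nonneg fun w _ => (Real.cosh_pos _).le
    positivity
  rw [sub_div, div_self (by positivity : (N : ℝ) * V ≠ 0)] at hf
  have hpos2 : 0 ≤ (∑ b ∈ HB, (∑ l, x b (f l)) ^ 2) / (N * V) := by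
    have : 0 ≤ ∑ b ∈ HB, (∑ l, x b (f l)) ^ 2 := Finset.sum_nonneg fun w _ => sq_nonneg _
    positivity
  refine ⟨f, fun w hw => ?_, ?_⟩
  · have h1 : (∑ w ∈ HW, Real.cosh (lam * ∑ l, y w (f l))) / (M * E ^ N) ≤ 2 := by linarith
    rw [div_le_iff₀ (by positivity)] at h1
    have := Finset.single_le_sum (f := fun w => Real.cosh (lam * ∑ l, y w (f l)))
      (fun w _ => (Real.cosh_pos _).le) hw
    calc _ ≤ _ := this
      _ ≤ _ := h1
      _ = _ := by ring
  · have h1 : (∑ b ∈ HB, (∑ l, x b (f l)) ^ 2) / (N * V) ≤ 2 := by linarith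
    rw [div_le_iff₀ (by positivity)] at h1
    linarith
section
variable {ι : Type*} [Fintype ι] [DecidableEq ι]

/-- signed scaled coordinate vector -/
noncomputable def atomv (R : ℝ) (c : ι × Bool) : ι → ℝ :=
  (if c.2 then R else -R) • (Pi.single c.1 (1 : ℝ) : ι → ℝ)

noncomputable def netv (R : ℝ) {N : ℕ} (f : Fin N → ι × Bool) : ι → ℝ :=
  (N : ℝ)⁻¹ • ∑ l, atomv R (f l)

lemma lin_sum (T : (ι → ℝ) →ₗ[ℝ] ℝ) (z : ι → ℝ) : T z = ∑ a, z a * T (Pi.single a 1) := by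
  have := LinearMap.pi_apply_eq_sum_univ T z
  rw [this]
  refine Finset.sum_congr rfl fun a _ => ?_
  rw [smul_eq_mul]
  congr 2
  ext b; simp [Pi.single_apply, eq_comm]

lemma quad_bound {B : Type*} (HB : Finset B) (x : B → (ι → ℝ) →ₗ[ℝ] ℝ) (U : ℝ)
    (hU : ∀ a, ∑ b ∈ HB, (x b (Pi.single a 1)) ^ 2 ≤ U) (z : ι → ℝ) :
    ∑ b ∈ HB, (x b z) ^ 2 ≤ (l1 z) ^ 2 * U := by
  have h1 : ∀ b ∈ HB, (x b z) ^ 2 ≤ l1 z * ∑ a, |z a| * (x b (Pi.single a 1)) ^ 2 := by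
    intro b _
    rw [lin_sum (x b) z]
    have := Finset.sum_mul_sq_le_sq_mul_sq (R := ℝ) Finset.univ (fun a => Real.sqrt |z a|)
      (fun a => Real.sqrt |z a| * |x b (Pi.single a 1)|)
    have e1 : ∀ a, Real.sqrt |z a| * (Real.sqrt |z a| * |x b (Pi.single a 1)|) = |z a * x b (Pi.single a 1)| := by
      intro a; rw [← mul_assoc, Real.mul_self_sqrt (abs_nonneg _), abs_mul]
    have e2 : ∀ a, (Real.sqrt |z a| * |x b (Pi.single a 1)|) ^ 2 = |z a| * (x b (Pi.single a 1)) ^ 2 := by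
      intro a; rw [mul_pow, Real.sq_sqrt (abs_nonneg _), sq_abs]
    simp only [e1, e2, Real.sq_sqrt (abs_nonneg _)] at this
    refine le_trans ?_ this
    rw [← sq_abs]
    gcongr
    exact Finset.abs_sum_le_sum_abs _ _
  have hl : 0 ≤ l1 z := Finset.sum_nonneg fun _ _ => abs_nonneg _
  calc _ ≤ ∑ b ∈ HB, l1 z * ∑ a, |z a| * (x b (Pi.single a 1)) ^ 2 := Finset.sum_le_sum h1
    _ = l1 z * ∑ a, |z a| * ∑ b ∈ HB, (x b (Pi.single a 1)) ^ 2 := by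
        rw [← Finset.mul_sum, Finset.sum_comm]
        simp_rw [Finset.mul_sum]
    _ ≤ l1 z * ∑ a, |z a| * U := by
        refine mul_le_mul_of_nonneg_left (Finset.sum_le_sum fun a _ => ?_) hl
        exact mul_le_mul_of_nonneg_left (hU a) (abs_nonneg _)
    _ = _ := by rw [← Finset.sum_mul]; unfold l1; ring

lemma abs_lin_bound (T : (ι → ℝ) →ₗ[ℝ] ℝ) (K : ℝ) (hK : ∀ a, |T (Pi.single a 1)| ≤ K) (z : ι → ℝ) :
    |T z| ≤ l1 z * K := by
  rw [lin_sum T z, l1, Finset.sum_mul]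
  refine (Finset.abs_sum_le_sum_abs _ _).trans (Finset.sum_le_sum fun a _ => ?_)
  rw [abs_mul]
  exact mul_le_mul_of_nonneg_left (hK a) (abs_nonneg _)

lemma maurey_net [Nonempty ι] {W B : Type*} (HW : Finset W) (HB : Finset B)
    (y : W → (ι → ℝ) →ₗ[ℝ] ℝ) (x : B → (ι → ℝ) →ₗ[ℝ] ℝ) (K U R lam : ℝ) (hK : 0 < K) (hU : 0 < U)
    (hR : 0 < R) (z : ι → ℝ) (hz : l1 z ≤ R)
    (hy : ∀ w ∈ HW, ∀ a, |y w (Pi.single a 1)| ≤ K)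
    (hx : ∀ a, ∑ b ∈ HB, (x b (Pi.single a 1)) ^ 2 ≤ U)
    (M : ℝ) (hM : 0 < M) (hMc : (HW.card : ℝ) ≤ M) (N : ℕ) (hN : 0 < N) :
    ∃ f : Fin N → ι × Bool,
      (∀ w ∈ HW, Real.cosh (lam * (N * y w (netv R f - z))) ≤ 2 * M * Real.exp (lam ^ 2 * (2 * R * K) ^ 2 / 2) ^ N)
      ∧ ∑ b ∈ HB, (x b (netv R f - z)) ^ 2 ≤ 8 * R ^ 2 * U / N := by
  have hN' : (0 : ℝ) < N := by exact_mod_cast hN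
  have hc : (0 : ℝ) < Fintype.card ι := by exact_mod_cast Fintype.card_pos
  set q : ι × Bool → ℝ := fun c => (|z c.1| + (if c.2 then z c.1 else - z c.1)) / (2 * R)
    + (1 - l1 z / R) / (2 * Fintype.card ι) with hq
  have hq0 : ∀ c, 0 ≤ q c := by
    intro c
    have h1 : 0 ≤ |z c.1| + (if c.2 then z c.1 else - z c.1) := by
      split_ifs
      · linarith [neg_abs_le (z c.1)]
      · linarith [le_abs_self (z c.1)]
    have h2 : 0 ≤ 1 - l1 z / R := by
      rw [sub_nonneg, div_le_one hR]; exact hz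
    simp only [hq]
    positivity
  have hq1 : ∑ c, q c = 1 := by
    rw [Fintype.sum_prod_type]
    simp only [hq, Fintype.sum_bool, if_true, Bool.false_eq_true, if_false]
    have : ∀ a, (|z a| + z a) / (2 * R) + (1 - l1 z / R) / (2 * Fintype.card ι) +
        ((|z a| + -z a) / (2 * R) + (1 - l1 z / R) / (2 * Fintype.card ι))
        = |z a| / R + (1 - l1 z / R) / Fintype.card ι := by
      intro a; field_simp; ring
    simp only [this, Finset.sum_add_distrib, ← Finset.sum_div]
    simp only [Finset.sum_const, Finset.card_univ, nsmul_eq_mul]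
    change l1 z / R + _ = 1
    field_simp; ring
  have hatom : ∀ (T : (ι → ℝ) →ₗ[ℝ] ℝ) c, T (atomv R c) = (if c.2 then R else -R) * T (Pi.single c.1 1) := by
    intro T c; rw [atomv, map_smul, smul_eq_mul]
  have hmean : ∀ T : (ι → ℝ) →ₗ[ℝ] ℝ, ∑ c, q c * T (atomv R c - z) = 0 := by
    intro T
    have : ∀ c, q c * T (atomv R c - z) = q c * T (atomv R c) - q c * T z := by
      intro c; rw [map_sub]; ring
    simp only [this, Finset.sum_sub_distrib, ← Finset.sum_mul, hq1, one_mul]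
    rw [sub_eq_zero, Fintype.sum_prod_type, lin_sum T z]
    refine Finset.sum_congr rfl fun a _ => ?_
    simp only [hatom, Fintype.sum_bool, if_true, Bool.false_eq_true, if_false, hq]
    field_simp; ring
  have hnet : ∀ (T : (ι → ℝ) →ₗ[ℝ] ℝ) (f : Fin N → ι × Bool),
      ∑ l, T (atomv R (f l) - z) = N * T (netv R f - z) := by
    intro T f
    simp only [map_sub, Finset.sum_sub_distrib, netv, map_smul, map_sum, smul_eq_mul]
    simp; field_simp
  have hal1 : ∀ c : ι × Bool, l1 (atomv R c) = R := by
    intro c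
    simp only [l1, atomv, Pi.smul_apply, smul_eq_mul, abs_mul]
    rw [← Finset.mul_sum]
    have : ∑ i, |(Pi.single c.1 (1 : ℝ) : ι → ℝ) i| = 1 := by
      rw [Finset.sum_eq_single c.1] <;> simp +contextual [Pi.single_apply]
    rw [this]
    split_ifs <;> simp [abs_of_pos hR]
  have hl : 0 ≤ l1 z := Finset.sum_nonneg fun _ _ => abs_nonneg _
  obtain ⟨f, hf1, hf2⟩ := maurey_abs HW HB q hq0 hq1 (fun w c => y w (atomv R c - z))
    (fun b c => x b (atomv R c - z)) (fun w _ => hmean _) (fun b _ => hmean _) (2 * R * K) (4 * R ^ 2 * U) lam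
    (by positivity) (by positivity) (by
      intro w hw c
      rw [map_sub]
      have h1 := abs_lin_bound (y w) K (hy w hw) (atomv R c)
      have h2 := abs_lin_bound (y w) K (hy w hw) z
      rw [hal1] at h1
      have h3 : l1 z * K ≤ R * K := by gcongr
      have := abs_sub (y w (atomv R c)) (y w z)
      linarith) (by
      intro c
      have h1 := quad_bound HB x U hx (atomv R c)
      have h2 := quad_bound HB x U hx z
      rw [hal1] at h1
      have h3 : (l1 z) ^ 2 * U ≤ R ^ 2 * U := by gcongr
      have h4 : ∑ b ∈ HB, (x b (atomv R c - z)) ^ 2 ≤ ∑ b ∈ HB, (2 * (x b (atomv R c)) ^ 2 + 2 * (x b z) ^ 2) := by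
        refine Finset.sum_le_sum fun b _ => ?_
        rw [map_sub]
        nlinarith [sq_nonneg (x b (atomv R c) + x b z)]
      rw [Finset.sum_add_distrib, ← Finset.mul_sum, ← Finset.mul_sum] at h4
      linarith) M hM hMc N hN
  refine ⟨f, fun w hw => ?_, ?_⟩
  · have := hf1 w hw
    rwa [hnet] at this
  · simp only [hnet, mul_pow] at hf2
    rw [← Finset.mul_sum] at hf2
    rw [le_div_iff₀ hN']
    have h5 : (N : ℝ) * (N * ∑ b ∈ HB, (x b (netv R f - z)) ^ 2) ≤ N * (8 * R ^ 2 * U) := by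
      nlinarith
    have := le_of_mul_le_mul_left h5 hN'
    linarith
end
section
variable {p n : ℕ}

noncomputable def wvL (m ω : ℕ) (i : Fin p) (τ : Fin m) : (Fin p × Fin n → ℝ) →ₗ[ℝ] ℝ where
  toFun z := wv m ω z i τ
  map_add' x y := by simp [wv, add_mul, Finset.sum_add_distrib]
  map_smul' c x := by simp [wv, Finset.mul_sum, mul_assoc]

lemma wvL_apply (m ω : ℕ) (i : Fin p) (τ : Fin m) (z : Fin p × Fin n → ℝ) :
    wvL m ω i τ z = wv m ω z i τ := rfl

noncomputable def YYL (m ω : ℕ) (φ : Fin p → Fin m → ℝ) : (Fin p × Fin n → ℝ) →ₗ[ℝ] ℝ where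
  toFun z := YY m ω z φ
  map_add' x y := by
    simp only [YY, linY, ← wvL_apply, map_add, add_mul, Finset.sum_add_distrib]
  map_smul' c x := by
    simp only [YY, linY, ← wvL_apply, map_smul, smul_eq_mul, Finset.mul_sum, mul_assoc, RingHom.id_apply]

lemma YYL_apply (m ω : ℕ) (φ : Fin p → Fin m → ℝ) (z : Fin p × Fin n → ℝ) :
    YYL m ω φ z = YY m ω z φ := rfl

noncomputable def xL (m : ℕ) (b : ℕ × Fin p × Fin m) : (Fin p × Fin n → ℝ) →ₗ[ℝ] ℝ :=
  (Real.sqrt m)⁻¹ • wvL m b.1 b.2.1 b.2.2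

lemma xL_sum (m ω : ℕ) (z : Fin p × Fin n → ℝ) :
    ∑ b : Fin p × Fin m, (xL m (ω, b) z) ^ 2 = SS m ω z := by
  rw [Fintype.sum_prod_type, SS, Finset.sum_div]
  refine Finset.sum_congr rfl fun i _ => ?_
  rw [Finset.sum_div]
  refine Finset.sum_congr rfl fun τ _ => ?_
  simp only [xL, LinearMap.smul_apply, smul_eq_mul, wvL_apply]
  rw [mul_pow, inv_pow, Real.sq_sqrt (Nat.cast_nonneg _)]
  ring

lemma SS_nonneg (m ω : ℕ) (z : Fin p × Fin n → ℝ) : 0 ≤ SS m ω z := by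
  unfold SS; positivity

lemma wv_single (m ω : ℕ) (a : Fin p × Fin n) (i : Fin p) (τ : Fin m) :
    wv m ω (Pi.single a 1) i τ = if i = a.1 then Real.cos (2 * Real.pi * ω / m * ((τ : ℝ) + a.2)) else 0 := by
  obtain ⟨a, b⟩ := a
  simp only [wv]
  split_ifs with h
  · subst h
    rw [Finset.sum_eq_single b]
    · simp
    · intro k _ hk
      rw [Pi.single_eq_of_ne (by simpa using hk), zero_mul]
    · simp
  · refine Finset.sum_eq_zero fun k _ => ?_
    rw [Pi.single_eq_of_ne (by simp [h]), zero_mul]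

lemma SS_single (m ω : ℕ) (a : Fin p × Fin n) : SS m ω (Pi.single a 1) ≤ 1 := by
  unfold SS
  refine div_le_one_of_le₀ ?_ (Nat.cast_nonneg _)
  have : ∀ i, ∑ τ : Fin m, (wv m ω (Pi.single a 1) i τ) ^ 2 ≤ if i = a.1 then (m : ℝ) else 0 := by
    intro i
    simp only [wv_single]
    split_ifs
    · calc _ ≤ ∑ τ : Fin m, (1 : ℝ) := Finset.sum_le_sum fun τ _ => Real.cos_sq_le_one _
        _ = m := by simp
    · simp
  refine (Finset.sum_le_sum fun i _ => this i).trans ?_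
  simp

lemma SS_le (m ω : ℕ) (z : Fin p × Fin n → ℝ) : SS m ω z ≤ (l1 z) ^ 2 := by
  have := quad_bound Finset.univ (fun b : Fin p × Fin m => xL m (ω, b)) 1
    (fun a => by rw [xL_sum]; exact SS_single m ω a) z
  rwa [xL_sum, mul_one] at this

/-- abbreviation for the frequency window -/
noncomputable def HH (m : ℕ) : Finset ℕ := Finset.range (m / 2 + 1)

lemma level_step {m : ℕ} [Nonempty (Fin p × Fin n)] (φ : Fin p → Fin m → ℝ) (K R T M κ : ℝ) (hK : 0 < K) (hR : 0 < R) (hT : 0 < T)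
    (hM : 1 ≤ M) (hMc : ((HH m).card : ℝ) ≤ M) (N : ℕ) (hN1 : 64 * R ^ 2 ≤ N * T)
    (hN2 : 1280000 * Real.log (4 * M) * R ^ 2 * K ^ 2 ≤ N * T)
    (hy : ∀ ω ∈ HH m, ∀ a : Fin p × Fin n, |YY m ω (Pi.single a 1) φ| ≤ K)
    (hκ : 0 < κ)
    (hnet : ∀ f : Fin N → (Fin p × Fin n) × Bool,
      κ / 2 ≤ (((HH m).filter fun ω => T / 4 ≤ SS m ω (netv R f)).card : ℝ) →
      2 * ((((HH m).filter fun ω => T / 4 ≤ SS m ω (netv R f)).filter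
        fun ω => |YY m ω (netv R f) φ| < Real.sqrt T / 200).card : ℝ) <
        (((HH m).filter fun ω => T / 4 ≤ SS m ω (netv R f)).card : ℝ))
    (z : Fin p × Fin n → ℝ) (hz : l1 z ≤ R)
    (hΩ : κ ≤ (((HH m).filter fun ω => T ≤ SS m ω z).card : ℝ)) :
    (((HH m).filter fun ω => T ≤ SS m ω z).card : ℝ) / 4 ≤
      (((HH m).filter fun ω => Real.sqrt T / 400 ≤ |YY m ω z φ|).card : ℝ) := by
  classical
  have hNT : 0 < (N : ℝ) * T := by nlinarith [sq_pos_of_pos hR]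
  have hN' : (0 : ℝ) < N := by
    by_contra h
    push Not at h
    nlinarith
  have hN : 0 < N := by exact_mod_cast hN'
  set Ω := (HH m).filter fun ω => T ≤ SS m ω z with hΩd
  have hU : (0 : ℝ) < Ω.card := lt_of_lt_of_le hκ hΩ
  have hsT : 0 < Real.sqrt T := Real.sqrt_pos.2 hT
  have hsT2 : Real.sqrt T ^ 2 = T := Real.sq_sqrt hT.le
  set t := Real.sqrt T / 400 with ht
  have htp : 0 < t := by positivity
  set B := 2 * R * K with hB
  have hBp : 0 < B := by positivity
  have hsumx : ∀ v : Fin p × Fin n → ℝ, ∑ b ∈ Ω ×ˢ (Finset.univ : Finset (Fin p × Fin m)), (xL m b v) ^ 2 = ∑ ω ∈ Ω, SS m ω v := by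
    intro v
    rw [Finset.sum_product]
    exact Finset.sum_congr rfl fun ω _ => xL_sum m ω v
  obtain ⟨f, hf1, hf2⟩ := maurey_net (HH m) (Ω ×ˢ (Finset.univ : Finset (Fin p × Fin m)))
    (fun ω => YYL m ω φ) (fun b => xL m b) K Ω.card R (t / B ^ 2) hK hU hR z hz hy
    (by
      intro a
      rw [hsumx]
      refine (Finset.sum_le_sum fun ω _ => SS_single m ω a).trans ?_
      simp) M (by linarith) hMc N hN
  rw [hsumx] at hf2
  have hclose : ∀ ω ∈ HH m, |YY m ω (netv R f - z) φ| ≤ t := by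
    intro ω hω
    have h1 := hf1 ω hω
    rw [YYL_apply] at h1
    set y := YY m ω (netv R f - z) φ
    have hl : 0 < t / B ^ 2 := by positivity
    have h2 : Real.exp (t / B ^ 2 * (N * |y|)) ≤ 4 * M * Real.exp (N * ((t / B ^ 2) ^ 2 * B ^ 2 / 2)) := by
      have h3 : Real.exp |t / B ^ 2 * (N * y)| ≤ 2 * Real.cosh (t / B ^ 2 * (N * y)) := by
        rw [← Real.cosh_abs, Real.cosh_eq]
        have := Real.exp_pos (-|t / B ^ 2 * (N * y)|)
        linarith
      rw [abs_mul, abs_mul, abs_of_pos hl, abs_of_pos hN'] at h3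
      rw [Real.exp_nat_mul]
      linarith
    rw [← Real.exp_log (show 0 < 4 * M by linarith), ← Real.exp_add, Real.exp_le_exp] at h2
    have e1 : t ^ 2 = T / 160000 := by rw [ht, div_pow, hsT2]; norm_num
    have hN3 : 2 * Real.log (4 * M) * B ^ 2 ≤ N * t ^ 2 := by
      rw [e1, hB]; nlinarith
    have h4 : t / B ^ 2 * (N * |y|) ≤ t / B ^ 2 * (N * t) := by
      have e2 : t / B ^ 2 * (N * t) = (N * t ^ 2) / B ^ 2 := by ring
      have e3 : (N : ℝ) * ((t / B ^ 2) ^ 2 * B ^ 2 / 2) = (N * t ^ 2) / B ^ 2 / 2 := by field_simp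
      rw [e2]
      rw [e3] at h2
      have : 2 * Real.log (4 * M) ≤ N * t ^ 2 / B ^ 2 := by
        rw [le_div_iff₀ (by positivity)]; exact hN3
      linarith
    have h5 := le_of_mul_le_mul_left h4 hl
    exact le_of_mul_le_mul_left h5 hN'
  set z' := netv R f with hz'
  set Z := (HH m).filter fun ω => T / 4 ≤ SS m ω z' with hZ
  -- many of the frequencies in Ω survive
  have hsurv : (Ω.card : ℝ) / 2 ≤ (Ω.filter fun ω => T / 4 ≤ SS m ω z').card := by
    have h1 : ∀ ω ∈ Ω.filter (fun ω => ¬ T / 4 ≤ SS m ω z'), T / 4 ≤ SS m ω (z' - z) := by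
      intro ω hω
      rw [Finset.mem_filter, hΩd, Finset.mem_filter] at hω
      obtain ⟨⟨_, h2⟩, h3⟩ := hω
      push Not at h3
      rw [← xL_sum] at h2 h3 ⊢
      have h4 : ∑ b : Fin p × Fin m, (xL m (ω, b) z) ^ 2 ≤ ∑ b : Fin p × Fin m, (2 * (xL m (ω, b) z') ^ 2 + 2 * (xL m (ω, b) (z' - z)) ^ 2) := by
        refine Finset.sum_le_sum fun b _ => ?_
        rw [map_sub]
        nlinarith [sq_nonneg (2 * xL m (ω, b) z' - xL m (ω, b) z)]
      rw [Finset.sum_add_distrib, ← Finset.mul_sum, ← Finset.mul_sum] at h4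
      linarith
    have h2 : ((Ω.filter (fun ω => ¬ T / 4 ≤ SS m ω z')).card : ℝ) * (T / 4) ≤ ∑ ω ∈ Ω, SS m ω (z' - z) := by
      rw [← nsmul_eq_mul]
      refine (Finset.card_nsmul_le_sum _ _ _ h1).trans ?_
      exact Finset.sum_le_sum_of_subset_of_nonneg (Finset.filter_subset _ _) fun _ _ _ => SS_nonneg _ _ _
    have h3 : 8 * R ^ 2 * Ω.card / N ≤ Ω.card * (T / 8) := by
      rw [div_le_iff₀ hN']
      nlinarith
    have h4 : ((Ω.filter (fun ω => ¬ T / 4 ≤ SS m ω z')).card : ℝ) ≤ Ω.card / 2 := by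
      have : ((Ω.filter (fun ω => ¬ T / 4 ≤ SS m ω z')).card : ℝ) * (T / 4) ≤ (Ω.card / 2) * (T / 4) := by linarith
      exact le_of_mul_le_mul_right this (by positivity)
    have h5 := Finset.card_filter_add_card_filter_not (s := Ω) (fun ω => T / 4 ≤ SS m ω z')
    have h6 : ((Ω.filter (fun ω => T / 4 ≤ SS m ω z')).card : ℝ) + (Ω.filter (fun ω => ¬ T / 4 ≤ SS m ω z')).card = Ω.card := by
      exact_mod_cast h5
    linarith
  have hZc : (Ω.card : ℝ) / 2 ≤ Z.card := by
    refine hsurv.trans ?_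
    exact_mod_cast Finset.card_le_card (Finset.filter_subset_filter _ (Finset.filter_subset _ _))
  have hn := hnet f (by linarith)
  have h7 : (Z.filter (fun ω => |YY m ω z' φ| < Real.sqrt T / 200)).card + (Z.filter (fun ω => ¬ |YY m ω z' φ| < Real.sqrt T / 200)).card = Z.card :=
    Finset.card_filter_add_card_filter_not (s := Z) _
  have h8 : ((Z.filter (fun ω => |YY m ω z' φ| < Real.sqrt T / 200)).card : ℝ) + (Z.filter (fun ω => ¬ |YY m ω z' φ| < Real.sqrt T / 200)).card = Z.card := by
    exact_mod_cast h7
  have h9 : ((Z.filter (fun ω => ¬ |YY m ω z' φ| < Real.sqrt T / 200)).card : ℝ) ≤ ((HH m).filter fun ω => t ≤ |YY m ω z φ|).card := by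
    have : Z.filter (fun ω => ¬ |YY m ω z' φ| < Real.sqrt T / 200) ⊆ (HH m).filter fun ω => t ≤ |YY m ω z φ| := by
      intro ω hω
      rw [Finset.mem_filter, hZ, Finset.mem_filter] at hω
      obtain ⟨⟨ha, _⟩, hb⟩ := hω
      rw [Finset.mem_filter]
      refine ⟨ha, ?_⟩
      push Not at hb
      have hc := hclose ω ha
      rw [← YYL_apply, map_sub, YYL_apply, YYL_apply] at hc
      have := abs_sub_abs_le_abs_sub (YY m ω z' φ) (YY m ω z φ)
      have e : Real.sqrt T / 200 = 2 * t := by rw [ht]; ring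
      linarith
    exact_mod_cast Finset.card_le_card this
  linarith
end
noncomputable def Tl (j : ℕ) : ℝ := 4 ^ j / 8

lemma Tl_pos (j : ℕ) : 0 < Tl j := by unfold Tl; positivity

lemma Tl_succ (j : ℕ) : Tl (j + 1) = 4 * Tl j := by unfold Tl; rw [pow_succ]; ring

lemma layer_a (S : ℝ) (ν : ℕ) (h : S < Tl ν) :
    S ≤ 1 / 8 + 4 * ∑ j ∈ Finset.range ν, (if Tl j ≤ S then Tl j else 0) := by
  induction ν with
  | zero => simp [Tl] at h ⊢; linarith
  | succ ν ih =>
    rw [Finset.sum_range_succ]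
    by_cases h1 : Tl ν ≤ S
    · rw [if_pos h1]
      rw [Tl_succ] at h
      have : 0 ≤ ∑ j ∈ Finset.range ν, (if Tl j ≤ S then Tl j else 0) :=
        Finset.sum_nonneg fun j _ => by split_ifs <;> linarith [Tl_pos j]
      linarith
    · rw [if_neg h1]
      have := ih (not_le.1 h1)
      linarith

lemma layer_b (q : ℝ) (hq : 0 ≤ q) (ν : ℕ) :
    ∑ j ∈ Finset.range ν, (if Tl j ≤ q then Tl j else 0) ≤ 4 / 3 * q := by
  have h0 : ∀ ν, ∑ j ∈ Finset.range ν, (if Tl j ≤ q then Tl j else 0) ≤ Tl ν / 3 := by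
    intro ν
    induction ν with
    | zero => simp [Tl]; norm_num
    | succ ν ih =>
      rw [Finset.sum_range_succ, Tl_succ]
      have : (if Tl ν ≤ q then Tl ν else 0) ≤ Tl ν := by split_ifs <;> linarith [Tl_pos ν]
      linarith
  induction ν with
  | zero => simpa using hq
  | succ ν ih =>
    rw [Finset.sum_range_succ]
    split_ifs with h
    · linarith [h0 ν]
    · linarith

lemma sum_card_swap (H : Finset ℕ) (ν : ℕ) (P : ℕ → ℕ → Prop) [∀ j ω, Decidable (P j ω)] :
    ∑ j ∈ Finset.range ν, Tl j * ((H.filter fun ω => P j ω).card : ℝ)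
      = ∑ ω ∈ H, ∑ j ∈ Finset.range ν, (if P j ω then Tl j else 0) := by
  rw [Finset.sum_comm]
  refine Finset.sum_congr rfl fun j _ => ?_
  rw [← Finset.sum_filter, Finset.sum_const, nsmul_eq_mul, mul_comm]

lemma HH_card (m : ℕ) (hm : 2 ≤ m) : ((HH m).card : ℝ) ≤ m := by
  have : (HH m).card ≤ m := by rw [HH, Finset.card_range]; omega
  exact_mod_cast this

lemma lower_bound {p n m ν : ℕ} (hm : 2 ≤ m) (hn : n ≤ m) (φ : Fin p → Fin m → ℝ) (R : ℝ)
    (hR : R ^ 2 < Tl ν) (z : Fin p × Fin n → ℝ) (hz : l1 z ≤ R) (hz2 : ∑ a, z a ^ 2 = 1)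
    (hlev : ∀ j < ν, (m : ℝ) / (64 * ν * Tl j) ≤ (((HH m).filter fun ω => Tl j ≤ SS m ω z).card : ℝ) →
      (((HH m).filter fun ω => Tl j ≤ SS m ω z).card : ℝ) / 4 ≤
      (((HH m).filter fun ω => Real.sqrt (Tl j) / 400 ≤ |YY m ω z φ|).card : ℝ)) :
    1 / 400000000 ≤ ∑ j, (linProbeMatrix p n m φ).mulVec z j ^ 2 := by
  have hm0 : (0 : ℝ) < m := by exact_mod_cast (by omega : 0 < m)
  have hH := HH_card m hm
  have hl : 0 ≤ l1 z := Finset.sum_nonneg fun _ _ => abs_nonneg _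
  have h1 := SS_sum m (by omega) hn z
  rw [hz2, mul_one] at h1
  change _ ≤ ∑ ω ∈ HH m, _ at h1
  have h2 : ∑ ω ∈ HH m, SS m ω z ≤ ∑ ω ∈ HH m, (1 / 8 + 4 * ∑ j ∈ Finset.range ν, (if Tl j ≤ SS m ω z then Tl j else 0)) := by
    refine Finset.sum_le_sum fun ω _ => layer_a _ ν ?_
    refine lt_of_le_of_lt (SS_le m ω z) (lt_of_le_of_lt ?_ hR)
    gcongr
  rw [Finset.sum_add_distrib, ← Finset.mul_sum, ← sum_card_swap, Finset.sum_const, nsmul_eq_mul] at h2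
  have h3 : ∀ j ∈ Finset.range ν, Tl j * (((HH m).filter fun ω => Tl j ≤ SS m ω z).card : ℝ) ≤
      4 * (Tl j * (((HH m).filter fun ω => Real.sqrt (Tl j) / 400 ≤ |YY m ω z φ|).card : ℝ)) + m / 64 / ν := by
    intro j hj
    rw [Finset.mem_range] at hj
    have hν : (0 : ℝ) < ν := by exact_mod_cast (by omega : 0 < ν)
    have hT := Tl_pos j
    rcases le_total ((m : ℝ) / (64 * ν * Tl j)) (((HH m).filter fun ω => Tl j ≤ SS m ω z).card : ℝ) with h | h
    · have h4 := mul_le_mul_of_nonneg_left (hlev j hj h) hT.le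
      have : 0 ≤ (m : ℝ) / 64 / ν := by positivity
      linarith
    · have h4 := mul_le_mul_of_nonneg_left h hT.le
      have e : Tl j * ((m : ℝ) / (64 * ν * Tl j)) = m / 64 / ν := by field_simp
      rw [e] at h4
      have : 0 ≤ Tl j * (((HH m).filter fun ω => Real.sqrt (Tl j) / 400 ≤ |YY m ω z φ|).card : ℝ) := by positivity
      linarith
  have h4 := Finset.sum_le_sum h3
  rw [Finset.sum_add_distrib, ← Finset.mul_sum, sum_card_swap (HH m) ν (fun j ω => Real.sqrt (Tl j) / 400 ≤ |YY m ω z φ|),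
    Finset.sum_const, nsmul_eq_mul, Finset.card_range] at h4
  have h5 : (ν : ℝ) * (m / 64 / ν) ≤ m / 64 := by
    rcases Nat.eq_zero_or_pos ν with h | h
    · subst h; simp; positivity
    · have hν : (0 : ℝ) < ν := by exact_mod_cast h
      field_simp; exact le_rfl
  have h6 : ∑ ω ∈ HH m, ∑ j ∈ Finset.range ν, (if Real.sqrt (Tl j) / 400 ≤ |YY m ω z φ| then Tl j else 0)
      ≤ ∑ ω ∈ HH m, 4 / 3 * 160000 * YY m ω z φ ^ 2 := by
    refine Finset.sum_le_sum fun ω _ => ?_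
    have := layer_b (160000 * YY m ω z φ ^ 2) (by positivity) ν
    rw [mul_assoc]
    refine le_trans (Finset.sum_le_sum fun j _ => ?_) this
    by_cases hc : Real.sqrt (Tl j) / 400 ≤ |YY m ω z φ|
    · rw [if_pos hc, if_pos]
      have : Real.sqrt (Tl j) ≤ 400 * |YY m ω z φ| := by linarith
      have := (Real.sqrt_le_left (by positivity)).1 this
      rw [mul_pow, sq_abs] at this
      linarith
    · rw [if_neg hc]
      split_ifs <;> linarith [Tl_pos j]
  rw [← Finset.mul_sum] at h6
  have h7 := YY_bessel m hm hn z φ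
  change ∑ ω ∈ HH m, _ ≤ _ at h7
  have h8 : (m : ℝ) * (1 / 400000000) ≤ m * ∑ j, (linProbeMatrix p n m φ).mulVec z j ^ 2 := by
    linarith
  exact le_of_mul_le_mul_left h8 hm0

lemma l1_smul {ι : Type*} [Fintype ι] (c : ℝ) (x : ι → ℝ) : l1 (c • x) = |c| * l1 x := by
  simp [l1, abs_mul, Finset.mul_sum]

lemma l2_nonneg {ι : Type*} [Fintype ι] (x : ι → ℝ) : 0 ≤ l2 x := Real.sqrt_nonneg _

lemma l2_smul {ι : Type*} [Fintype ι] (c : ℝ) (x : ι → ℝ) : l2 (c • x) = |c| * l2 x := by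
  simp only [l2, Pi.smul_apply, smul_eq_mul, mul_pow, ← Finset.mul_sum]
  rw [Real.sqrt_mul (sq_nonneg c), Real.sqrt_sq_eq_abs]

lemma l2_eq_norm {ι : Type*} [Fintype ι] (x : ι → ℝ) : l2 x = ‖WithLp.toLp 2 x‖ := by
  simp [l2, EuclideanSpace.norm_eq]

/-- the good event -/
def GoodEv (p n m ν : ℕ) (K R : ℝ) (Nn : ℕ → ℕ) (φ : Fin p → Fin m → ℝ) : Prop :=
  (∀ ω ∈ HH m, ∀ a : Fin p × Fin n, |YY m ω (Pi.single a 1) φ| ≤ K) ∧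
  ∀ j < ν, Tl j ≤ R ^ 2 → ∀ f : Fin (Nn j) → (Fin p × Fin n) × Bool,
      (m : ℝ) / (64 * ν * Tl j) / 2 ≤ (((HH m).filter fun ω => Tl j / 4 ≤ SS m ω (netv R f)).card : ℝ) →
      2 * ((((HH m).filter fun ω => Tl j / 4 ≤ SS m ω (netv R f)).filter
        fun ω => |YY m ω (netv R f) φ| < Real.sqrt (Tl j) / 200).card : ℝ) <
        (((HH m).filter fun ω => Tl j / 4 ≤ SS m ω (netv R f)).card : ℝ)

lemma good_lower {p n m ν : ℕ} (hp : 1 ≤ p) (hn2 : 2 ≤ n) (hm : 2 ≤ m) (hn : n ≤ m) (φ : Fin p → Fin m → ℝ) (K R M : ℝ)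
    (hK : 0 < K) (hR0 : 0 < R) (hM : 1 ≤ M) (hMc : (m : ℝ) ≤ M) (Nn : ℕ → ℕ)
    (hN1 : ∀ j, 64 * R ^ 2 ≤ Nn j * Tl j)
    (hN2 : ∀ j, 1280000 * Real.log (4 * M) * R ^ 2 * K ^ 2 ≤ Nn j * Tl j)
    (hR : R ^ 2 < Tl ν) (hg : GoodEv p n m ν K R Nn φ)
    (z : Fin p × Fin n → ℝ) (hz : l1 z ≤ R * l2 z) :
    l2 z ≤ 20000 * l2 ((linProbeMatrix p n m φ).mulVec z) := by
  have : Nonempty (Fin p × Fin n) := ⟨(⟨0, by omega⟩, ⟨0, by omega⟩)⟩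
  have hm0 : (0 : ℝ) < m := by exact_mod_cast (by omega : 0 < m)
  rcases (l2_nonneg z).eq_or_lt with h0 | h0
  · rw [← h0]; have := l2_nonneg ((linProbeMatrix p n m φ).mulVec z); positivity
  set v := (l2 z)⁻¹ • z with hv
  have hv1 : l1 v ≤ R := by
    rw [hv, l1_smul, abs_of_pos (by positivity), inv_mul_le_iff₀ h0]; linarith
  have hv2 : ∑ a, v a ^ 2 = 1 := by
    have : l2 v = 1 := by
      rw [hv, l2_smul, abs_of_pos (by positivity), inv_mul_cancel₀ h0.ne']
    rw [l2, Real.sqrt_eq_one] at this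
    exact this
  have hl : 0 ≤ l1 v := Finset.sum_nonneg fun _ _ => abs_nonneg _
  have key := lower_bound hm hn φ R hR v hv1 hv2 (by
    intro j hj hc
    have hT := Tl_pos j
    have hν : (0 : ℝ) < ν := by exact_mod_cast (by omega : 0 < ν)
    have hκ : (0 : ℝ) < (m : ℝ) / (64 * ν * Tl j) := by positivity
    refine level_step φ K R (Tl j) M _ hK hR0 hT hM ((HH_card m hm).trans hMc) (Nn j) (hN1 j) (hN2 j) hg.1 hκ
      (hg.2 j hj ?_) v hv1 hc
    have h1 : (0 : ℝ) < ((HH m).filter fun ω => Tl j ≤ SS m ω v).card := lt_of_lt_of_le hκ hc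
    have h2 : 0 < ((HH m).filter fun ω => Tl j ≤ SS m ω v).card := by exact_mod_cast h1
    obtain ⟨ω, hω⟩ := Finset.card_pos.1 h2
    rw [Finset.mem_filter] at hω
    refine hω.2.trans ((SS_le m ω v).trans ?_)
    gcongr)
  have h3 : (1 : ℝ) / 20000 ≤ l2 ((linProbeMatrix p n m φ).mulVec v) := by
    rw [l2]
    apply Real.le_sqrt_of_sq_le
    norm_num at key ⊢
    exact key
  rw [hv, Matrix.mulVec_smul, l2_smul, abs_of_pos (by positivity), ← div_eq_inv_mul, le_div_iff₀ h0] at h3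
  linarith

lemma cs_final {p n m s : ℕ} (hs : 2 ≤ s) (Φ : Matrix (Fin (m + n - 1)) (Fin p × Fin n) ℝ)
    (hΦ : ∀ z : Fin p × Fin n → ℝ, l1 z ≤ (4 * Real.sqrt s) * l2 z → l2 z ≤ 20000 * l2 (Φ.mulVec z))
    (h : Fin p × Fin n → ℝ) (ε : ℝ) (e : Fin (m + n - 1) → ℝ) (hε : 0 ≤ ε) (he : l2 e ≤ ε)
    (htil : Fin p × Fin n → ℝ) (h1 : l2 (fun j => Φ.mulVec htil j - (Φ.mulVec h j + e j)) ≤ ε)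
    (h2 : l1 htil ≤ l1 h) (hs' : Fin p × Fin n → ℝ) (hb : IsBestApprox s h hs') :
    l2 (htil - h) ≤ 40000 * (Real.sqrt 2 * ε + (Real.sqrt s)⁻¹ * l1 (h - hs')) := by
  obtain ⟨Γ, hc, ha, hz, -⟩ := hb
  set z := htil - h with hzd
  have hsp : 0 < Real.sqrt s := Real.sqrt_pos.2 (by exact_mod_cast (by omega : 0 < s))
  set σ := l1 (h - hs') with hσ
  have hσ0 : 0 ≤ σ := Finset.sum_nonneg fun _ _ => abs_nonneg _
  have hσe : σ = ∑ i ∈ Γᶜ, |h i| := by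
    rw [hσ, l1, ← Finset.sum_add_sum_compl Γ]
    rw [Finset.sum_eq_zero (s := Γ)]
    · rw [zero_add]
      refine Finset.sum_congr rfl fun i hi => ?_
      rw [Pi.sub_apply, hz i (Finset.mem_compl.1 hi), sub_zero]
    · intro i hi
      rw [Pi.sub_apply, ha i hi, sub_self, abs_zero]
  have hΓ : ∑ i ∈ Γ, |z i| ≤ Real.sqrt s * l2 z := by
    have h3 := Finset.sum_mul_sq_le_sq_mul_sq (R := ℝ) Γ (fun _ => 1) (fun i => |z i|)
    simp only [one_mul, one_pow, Finset.sum_const, nsmul_eq_mul, mul_one, sq_abs] at h3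
    have h4 : (Γ.card : ℝ) ≤ s := by
      have : Γ.card ≤ s := by rw [hc]; exact min_le_left _ _
      exact_mod_cast this
    have h5 : ∑ i ∈ Γ, z i ^ 2 ≤ ∑ i, z i ^ 2 :=
      Finset.sum_le_sum_of_subset_of_nonneg (Finset.subset_univ _) fun _ _ _ => sq_nonneg _
    rw [l2, ← Real.sqrt_mul (Nat.cast_nonneg _)]
    apply Real.le_sqrt_of_sq_le
    refine h3.trans ?_
    have : 0 ≤ ∑ i ∈ Γ, z i ^ 2 := Finset.sum_nonneg fun _ _ => sq_nonneg _
    gcongr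
  have hcone : l1 z ≤ 2 * (Real.sqrt s * l2 z) + 2 * σ := by
    have e1 : l1 htil = ∑ i ∈ Γ, |htil i| + ∑ i ∈ Γᶜ, |htil i| := (Finset.sum_add_sum_compl Γ _).symm
    have e2 : l1 h = ∑ i ∈ Γ, |h i| + ∑ i ∈ Γᶜ, |h i| := (Finset.sum_add_sum_compl Γ _).symm
    have e3 : l1 z = ∑ i ∈ Γ, |z i| + ∑ i ∈ Γᶜ, |z i| := (Finset.sum_add_sum_compl Γ _).symm
    have h6 : ∑ i ∈ Γ, |h i| ≤ ∑ i ∈ Γ, (|htil i| + |z i|) := by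
      refine Finset.sum_le_sum fun i _ => ?_
      have := abs_sub_abs_le_abs_sub (h i) (htil i)
      rw [abs_sub_comm] at this
      rw [hzd, Pi.sub_apply]; linarith
    have h7 : ∑ i ∈ Γᶜ, |z i| ≤ ∑ i ∈ Γᶜ, (|htil i| + |h i|) := by
      refine Finset.sum_le_sum fun i _ => ?_
      rw [hzd, Pi.sub_apply]; exact abs_sub _ _
    rw [Finset.sum_add_distrib] at h6 h7
    linarith
  have h20 : 1 ≤ Real.sqrt 2 := Real.one_le_sqrt.2 (by norm_num)
  rcases le_total σ (Real.sqrt s * l2 z) with hcase | hcase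
  · have h8 := hΦ z (by linarith)
    have h9 : l2 (Φ.mulVec z) ≤ ε + ε := by
      have e4 : Φ.mulVec z = (fun j => Φ.mulVec htil j - (Φ.mulVec h j + e j)) + e := by
        rw [hzd, Matrix.mulVec_sub]
        ext j; simp; ring
      rw [e4, l2_eq_norm, WithLp.toLp_add]
      refine (norm_add_le _ _).trans ?_
      rw [← l2_eq_norm, ← l2_eq_norm]
      exact add_le_add h1 he
    have h10 : 0 ≤ (Real.sqrt s)⁻¹ * σ := by positivity
    nlinarith
  · have h8 : l2 z ≤ (Real.sqrt s)⁻¹ * σ := by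
      rw [← div_eq_inv_mul, le_div_iff₀ hsp]; linarith
    have h10 : 0 ≤ Real.sqrt 2 * ε := by positivity
    have := l2_nonneg z
    linarith
lemma gm_mono {p m : ℕ} {S T : Set (Fin p → Fin m → ℝ)} (h : S ⊆ T) :
    (gaussMeasure p m).real S ≤ (gaussMeasure p m).real T :=
  measureReal_mono h (measure_ne_top _ _)

lemma bad1_le (p n m : ℕ) (hm : 2 ≤ m) (K : ℝ) (hK : 0 ≤ K) :
    (gaussMeasure p m).real {φ | ∃ ω ∈ HH m, ∃ a : Fin p × Fin n, K < |YY m ω (Pi.single a 1) φ|}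
      ≤ m * (n * p) * (2 * Real.exp (- K ^ 2 / 2)) := by
  have h1 : {φ : Fin p → Fin m → ℝ | ∃ ω ∈ HH m, ∃ a : Fin p × Fin n, K < |YY m ω (Pi.single a 1) φ|} ⊆
      ⋃ b ∈ (HH m) ×ˢ (Finset.univ : Finset (Fin p × Fin n)), {φ | K ≤ |linY (wv m b.1 (Pi.single b.2 1)) φ|} := by
    rintro φ ⟨ω, hω, a, h⟩
    simp only [Set.mem_iUnion]
    exact ⟨(ω, a), by simpa using hω, h.le⟩
  refine (gm_mono h1).trans ((measureReal_biUnion_finset_le _ _).trans ?_)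
  refine (Finset.sum_le_sum fun b _ => linY_tail_abs _ (SS_single m b.1 b.2) hK).trans ?_
  rw [Finset.sum_const, nsmul_eq_mul, Finset.card_product, Finset.card_univ, Fintype.card_prod,
    Fintype.card_fin, Fintype.card_fin]
  have := HH_card m hm
  have h2 := Real.exp_pos (- K ^ 2 / 2)
  push_cast
  rw [mul_comm (p : ℝ) n]
  gcongr

lemma bad2_one {p n m : ℕ} (T : ℝ) (hT : 0 < T) (z : Fin p × Fin n → ℝ) :
    (gaussMeasure p m).real {φ | ¬ 2 * ((((HH m).filter fun ω => T / 4 ≤ SS m ω z).filter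
        fun ω => |YY m ω z φ| < Real.sqrt T / 200).card : ℝ) <
        (((HH m).filter fun ω => T / 4 ≤ SS m ω z).card : ℝ)} ≤
      Real.exp (- (((HH m).filter fun ω => T / 4 ≤ SS m ω z).card : ℝ)) := by
  classical
  set Z := (HH m).filter fun ω => T / 4 ≤ SS m ω z with hZ
  have hsT : 0 < Real.sqrt T := Real.sqrt_pos.2 hT
  have hlt : ∀ w : Z, 2 * (w : ℕ) ≤ m := by
    rintro ⟨w, hw⟩
    rw [hZ, Finset.mem_filter, HH, Finset.mem_range] at hw
    show 2 * w ≤ m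
    omega
  have key := small_ball_count (p := p) (m := m) (fun w : Z => wv m (w : ℕ) z)
    (fun u v huv => wv_orth m u v (hlt u) (hlt v) (fun h => huv (Subtype.ext h)) z)
    (σ := Real.sqrt T / 2) (by positivity) (by
      rintro ⟨w, hw⟩
      rw [hZ, Finset.mem_filter] at hw
      have := hw.2
      rw [div_pow, Real.sq_sqrt hT.le]
      norm_num at this ⊢
      exact this)
  rw [Fintype.card_coe] at key
  refine le_trans (gm_mono ?_) key
  intro φ hφ
  rw [Set.mem_ofPred_eq] at hφ ⊢
  push Not at hφ
  have e : ∑ w : Z, Set.indicator {x : ℝ | |x| < Real.sqrt T / 2 / 100} (1 : ℝ → ℝ) (linY (wv m (w : ℕ) z) φ)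
      = ((Z.filter fun ω => |YY m ω z φ| < Real.sqrt T / 200).card : ℝ) := by
    rw [Finset.sum_coe_sort Z (fun w => Set.indicator {x : ℝ | |x| < Real.sqrt T / 2 / 100} (1 : ℝ → ℝ) (linY (wv m w z) φ))]
    rw [Finset.card_filter]
    push_cast
    refine Finset.sum_congr rfl fun w _ => ?_
    have e2 : Real.sqrt T / 2 / 100 = Real.sqrt T / 200 := by ring
    rw [e2, Set.indicator_apply]
    rfl
  rw [e]
  linarith

lemma bad2_level {p n m N : ℕ} (T R κ : ℝ) (hT : 0 < T) :
    (gaussMeasure p m).real {φ | ∃ f : Fin N → (Fin p × Fin n) × Bool,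
      κ ≤ (((HH m).filter fun ω => T / 4 ≤ SS m ω (netv R f)).card : ℝ) ∧
      ¬ 2 * ((((HH m).filter fun ω => T / 4 ≤ SS m ω (netv R f)).filter
        fun ω => |YY m ω (netv R f) φ| < Real.sqrt T / 200).card : ℝ) <
        (((HH m).filter fun ω => T / 4 ≤ SS m ω (netv R f)).card : ℝ)} ≤
      (2 * (n * p)) ^ N * Real.exp (- κ) := by
  classical
  set F : Finset (Fin N → (Fin p × Fin n) × Bool) := Finset.univ.filter fun f =>
    κ ≤ (((HH m).filter fun ω => T / 4 ≤ SS m ω (netv R f)).card : ℝ) with hF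
  refine le_trans (gm_mono (T := ⋃ f ∈ F, {φ | ¬ 2 * ((((HH m).filter fun ω => T / 4 ≤ SS m ω (netv R f)).filter
        fun ω => |YY m ω (netv R f) φ| < Real.sqrt T / 200).card : ℝ) <
        (((HH m).filter fun ω => T / 4 ≤ SS m ω (netv R f)).card : ℝ)}) ?_) ?_
  · rintro φ ⟨f, hf, h⟩
    simp only [Set.mem_iUnion]
    exact ⟨f, by rw [hF, Finset.mem_filter]; exact ⟨Finset.mem_univ _, hf⟩, h⟩
  · refine (measureReal_biUnion_finset_le _ _).trans ?_
    refine (Finset.sum_le_sum (g := fun _ => Real.exp (-κ)) fun f hf => (bad2_one T hT _).trans ?_).trans ?_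
    · rw [hF, Finset.mem_filter] at hf
      rw [Real.exp_le_exp]; linarith [hf.2]
    · rw [Finset.sum_const, nsmul_eq_mul]
      have : (F.card : ℝ) ≤ (2 * (n * p)) ^ N := by
        have h1 := Finset.card_le_univ F
        rw [Fintype.card_fun, Fintype.card_prod, Fintype.card_prod, Fintype.card_fin, Fintype.card_fin, Fintype.card_fin,
          Fintype.card_bool] at h1
        have h2 : (F.card : ℝ) ≤ ((p : ℝ) * n * 2) ^ N := by exact_mod_cast h1
        calc _ ≤ _ := h2
          _ = _ := by ring
      gcongr

lemma good_prob {p n m ν : ℕ} (hm : 2 ≤ m) (K R δ : ℝ) (hK : 0 ≤ K) (Nn : ℕ → ℕ)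
    (hδ : ∀ j < ν, Tl j ≤ R ^ 2 → (2 * ((n : ℝ) * p)) ^ (Nn j) * Real.exp (- ((m : ℝ) / (64 * ν * Tl j) / 2)) ≤ δ)
    (hδ0 : 0 ≤ δ) :
    (gaussMeasure p m).real {φ | ¬ GoodEv p n m ν K R Nn φ} ≤
      m * (n * p) * (2 * Real.exp (- K ^ 2 / 2)) + ν * δ := by
  classical
  set E : ℕ → Set (Fin p → Fin m → ℝ) := fun j => {φ | ∃ f : Fin (Nn j) → (Fin p × Fin n) × Bool,
      (m : ℝ) / (64 * ν * Tl j) / 2 ≤ (((HH m).filter fun ω => Tl j / 4 ≤ SS m ω (netv R f)).card : ℝ) ∧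
      ¬ 2 * ((((HH m).filter fun ω => Tl j / 4 ≤ SS m ω (netv R f)).filter
        fun ω => |YY m ω (netv R f) φ| < Real.sqrt (Tl j) / 200).card : ℝ) <
        (((HH m).filter fun ω => Tl j / 4 ≤ SS m ω (netv R f)).card : ℝ)} with hE
  have hsub : {φ | ¬ GoodEv p n m ν K R Nn φ} ⊆
      {φ | ∃ ω ∈ HH m, ∃ a : Fin p × Fin n, K < |YY m ω (Pi.single a 1) φ|} ∪
      ⋃ j ∈ (Finset.range ν).filter (fun j => Tl j ≤ R ^ 2), E j := by
    intro φ hφ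
    by_contra hcon
    rw [Set.mem_union, not_or] at hcon
    obtain ⟨h1, h2⟩ := hcon
    apply hφ
    refine ⟨fun ω hω a => ?_, fun j hj hT f hf => ?_⟩
    · by_contra h
      exact h1 ⟨ω, hω, a, not_le.1 h⟩
    · by_contra h
      apply h2
      simp only [Set.mem_iUnion]
      exact ⟨j, by simp [hj, hT], f, hf, h⟩
  refine (gm_mono hsub).trans ((measureReal_union_le _ _).trans ?_)
  refine add_le_add (bad1_le p n m hm K hK) ?_
  refine (measureReal_biUnion_finset_le _ _).trans ?_
  refine (Finset.sum_le_sum (g := fun _ => δ) fun j hj => ?_).trans ?_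
  · rw [Finset.mem_filter, Finset.mem_range] at hj
    exact (bad2_level (Tl j) R _ (Tl_pos j)).trans (hδ j hj.1 hj.2)
  · rw [Finset.sum_const, nsmul_eq_mul]
    have : (((Finset.range ν).filter (fun j => Tl j ≤ R ^ 2)).card : ℝ) ≤ ν := by
      have := Finset.card_filter_le (Finset.range ν) (fun j => Tl j ≤ R ^ 2)
      rw [Finset.card_range] at this
      exact_mod_cast this
    gcongr
theorem numerics (X L m s ν T : ℝ) (N : ℕ) (hX : 200 < X) (hL : L = Real.log X) (hL1 : 1 ≤ L)
    (hs : 2 ≤ s) (hm : 2000 * 327680000 * s * L ^ 6 ≤ m) (hν : 0 < ν) (hν3 : ν ≤ 3 * L)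
    (hT : 0 < T) (hT2 : T ≤ 16 * s) (hN : N * T ≤ 327680000 * s * L ^ 2 + T) :
    (2 * X) ^ N * Real.exp (- (m / (64 * ν * T) / 2)) ≤ (X ^ 2)⁻¹ := by
  have hX0 : 0 < X := by linarith
  have e1 : 2 * X = Real.exp (Real.log (2 * X)) := (Real.exp_log (by positivity)).symm
  have e2 : (X ^ 2)⁻¹ = Real.exp (-(2 * L)) := by
    rw [Real.exp_neg, two_mul, Real.exp_add, hL, Real.exp_log hX0, sq]
  rw [e1, ← Real.exp_nat_mul, ← Real.exp_add, e2, Real.exp_le_exp]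
  have hlog : Real.log (2 * X) ≤ 2 * L := by
    rw [Real.log_mul (by norm_num) hX0.ne', ← hL]
    have := Real.log_le_log (by norm_num : (0 : ℝ) < 2) (by linarith : (2 : ℝ) ≤ X)
    rw [← hL] at this; linarith
  have h0 : (N : ℝ) * Real.log (2 * X) ≤ N * (2 * L) := by gcongr
  have hL2 : 1 ≤ L ^ 2 := one_le_pow₀ hL1
  have hsL : s ≤ s * L ^ 2 := by nlinarith
  have h1 : N * T ≤ 2 * 327680000 * s * L ^ 2 := by nlinarith
  have h2 : (N * (2 * L) + 2 * L) * T ≤ 5 * 327680000 * s * L ^ 3 := by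
    have h3 : N * T * (2 * L) ≤ 2 * 327680000 * s * L ^ 2 * (2 * L) := by gcongr
    have h4 : T * (2 * L) ≤ (16 * (s * L ^ 2)) * (2 * L) := by
      have : T ≤ 16 * (s * L ^ 2) := by linarith
      gcongr
    have h5 : 0 ≤ s * L ^ 3 := by positivity
    nlinarith
  have h6 : N * (2 * L) + 2 * L ≤ m / (64 * ν * T) / 2 := by
    rw [div_div, le_div_iff₀ (by positivity)]
    have h7 : (N * (2 * L) + 2 * L) * (64 * ν * T * 2) = ((N * (2 * L) + 2 * L) * T) * (128 * ν) := by ring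
    rw [h7]
    have h8 : ((N * (2 * L) + 2 * L) * T) * (128 * ν) ≤ (5 * 327680000 * s * L ^ 3) * (128 * (3 * L)) := by
      gcongr
    have h9 : s * L ^ 4 ≤ s * L ^ 6 := by
      have : L ^ 4 ≤ L ^ 6 := pow_le_pow_right₀ hL1 (by norm_num)
      gcongr
    have h10 : 0 ≤ s * L ^ 4 := by positivity
    nlinarith
  linarith

theorem stmt3 : ∃ c C C' : ℝ, 0 < c ∧ 0 < C ∧ 0 < C' ∧
    ∀ (p n m s : ℕ), 1 ≤ p → 2 ≤ n → n ≤ m → m ≤ n * p → 2 ≤ s → s ≤ n * p →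
    c * s * (Real.log ((n : ℝ) * p)) ^ 6 ≤ m →
    1 - C' * (((n : ℝ) * p))⁻¹ ≤
      (gaussMeasure p m {φ |
        ∀ (h : Fin p × Fin n → ℝ) (ε : ℝ) (e : Fin (m + n - 1) → ℝ), 0 ≤ ε → l2 e ≤ ε →
          ∀ htil : Fin p × Fin n → ℝ,
            l2 (fun j => (linProbeMatrix p n m φ).mulVec htil j -
                ((linProbeMatrix p n m φ).mulVec h j + e j)) ≤ ε →
            l1 htil ≤ l1 h →
            ∀ hs : Fin p × Fin n → ℝ, IsBestApprox s h hs →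
              l2 (htil - h) ≤ C * (Real.sqrt 2 * ε + (Real.sqrt s)⁻¹ * l1 (h - hs))}).toReal := by
  refine ⟨2000 * 327680000, 40000, 200, by norm_num, by norm_num, by norm_num, ?_⟩
  intro p n m s hp hn hnm hmnp hs hsnp hc
  set X : ℝ := (n : ℝ) * p with hXd
  have hXpos : 0 < X := by
    have h1 : (0 : ℝ) < n := by exact_mod_cast (by omega : 0 < n)
    have h2 : (0 : ℝ) < p := by exact_mod_cast (by omega : 0 < p)
    positivity
  rcases le_or_gt X 200 with hX | hX
  · refine le_trans ?_ ENNReal.toReal_nonneg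
    have : 1 ≤ 200 * X⁻¹ := by rw [← div_eq_mul_inv, le_div_iff₀ hXpos]; linarith
    linarith
  have hm2 : 2 ≤ m := by omega
  have hmX : (m : ℝ) ≤ X := by rw [hXd]; exact_mod_cast hmnp
  have hsX : (s : ℝ) ≤ X := by rw [hXd]; exact_mod_cast hsnp
  have hs2 : (2 : ℝ) ≤ s := by exact_mod_cast hs
  set L := Real.log X with hL
  have hL1 : 1 ≤ L := by
    rw [hL, Real.le_log_iff_exp_le hXpos]
    have := Real.exp_one_lt_d9
    linarith
  have hLX : L ≤ X := by
    have := Real.log_le_sub_one_of_pos hXpos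
    linarith
  set ν := ⌈2 * L⌉₊ with hν
  have hν1 : 2 * L ≤ ν := Nat.le_ceil _
  have hν2 : (ν : ℝ) ≤ 3 * L := by
    have := Nat.ceil_lt_add_one (by linarith : 0 ≤ 2 * L)
    rw [← hν] at this; linarith
  have hν0 : (0 : ℝ) < ν := by linarith
  set R : ℝ := 4 * Real.sqrt s with hR
  have hR2 : R ^ 2 = 16 * s := by
    rw [hR, mul_pow, Real.sq_sqrt (by linarith)]; norm_num
  have hR0 : 0 < R := by
    have : 0 < Real.sqrt s := Real.sqrt_pos.2 (by linarith)
    positivity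
  set K : ℝ := Real.sqrt (8 * L) with hK
  have hK2 : K ^ 2 = 8 * L := by rw [hK, Real.sq_sqrt (by linarith)]
  have hK0 : 0 < K := Real.sqrt_pos.2 (by linarith)
  set Nn : ℕ → ℕ := fun j => ⌈327680000 * s * L ^ 2 / Tl j⌉₊ with hNn
  have hNlow : ∀ j, 327680000 * s * L ^ 2 ≤ Nn j * Tl j := by
    intro j
    rw [← div_le_iff₀ (Tl_pos j)]
    exact Nat.le_ceil _
  have hNup : ∀ j, Nn j * Tl j ≤ 327680000 * s * L ^ 2 + Tl j := by
    intro j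
    have hT := Tl_pos j
    have h1 : (Nn j : ℝ) ≤ 327680000 * s * L ^ 2 / Tl j + 1 :=
      (Nat.ceil_lt_add_one (by positivity)).le
    have h2 := mul_le_mul_of_nonneg_right h1 hT.le
    have e : (327680000 * s * L ^ 2 / Tl j + 1) * Tl j = 327680000 * s * L ^ 2 + Tl j := by field_simp
    linarith
  have hL2 : 1 ≤ L ^ 2 := one_le_pow₀ hL1
  have hlog4 : Real.log (4 * X) ≤ 2 * L := by
    rw [Real.log_mul (by norm_num) hXpos.ne', ← hL]
    have := Real.log_le_log (by norm_num : (0 : ℝ) < 4) (by linarith : (4 : ℝ) ≤ X)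
    linarith
  have hN1 : ∀ j, 64 * R ^ 2 ≤ Nn j * Tl j := by
    intro j
    refine le_trans ?_ (hNlow j)
    rw [hR2]; nlinarith
  have hN2 : ∀ j, 1280000 * Real.log (4 * X) * R ^ 2 * K ^ 2 ≤ Nn j * Tl j := by
    intro j
    refine le_trans ?_ (hNlow j)
    rw [hR2, hK2]
    have : 1280000 * Real.log (4 * X) * (16 * s) * (8 * L) ≤ 1280000 * (2 * L) * (16 * s) * (8 * L) := by
      gcongr
    refine this.trans (le_of_eq ?_)
    ring
  have hRν : R ^ 2 < Tl ν := by
    have h1 : X ^ 2 ≤ 4 ^ ν := by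
      have h2 : Real.exp 1 ^ ν ≤ 4 ^ ν := by
        have := Real.exp_one_lt_d9
        have := Real.exp_pos 1
        gcongr
        linarith
      rw [← Real.exp_nat_mul, mul_one] at h2
      have h3 : Real.exp (2 * L) ≤ Real.exp ν := Real.exp_le_exp.2 hν1
      rw [two_mul, Real.exp_add, hL, Real.exp_log hXpos] at h3
      nlinarith
    rw [hR2, Tl, lt_div_iff₀ (by norm_num)]
    nlinarith
  have hprob := good_prob (p := p) (n := n) (m := m) (ν := ν) hm2 K R (X ^ 2)⁻¹ hK0.le Nn (by
    intro j hj hTj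
    rw [hR2] at hTj
    exact numerics X L m s ν (Tl j) (Nn j) hX hL hL1 hs2 hc hν0 hν2 (Tl_pos j) hTj (hNup j)) (by positivity)
  set S := {φ : Fin p → Fin m → ℝ |
        ∀ (h : Fin p × Fin n → ℝ) (ε : ℝ) (e : Fin (m + n - 1) → ℝ), 0 ≤ ε → l2 e ≤ ε →
          ∀ htil : Fin p × Fin n → ℝ,
            l2 (fun j => (linProbeMatrix p n m φ).mulVec htil j -
                ((linProbeMatrix p n m φ).mulVec h j + e j)) ≤ ε →
            l1 htil ≤ l1 h →
            ∀ hs : Fin p × Fin n → ℝ, IsBestApprox s h hs →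
              l2 (htil - h) ≤ 40000 * (Real.sqrt 2 * ε + (Real.sqrt s)⁻¹ * l1 (h - hs))} with hS
  have hcover : Set.univ ⊆ S ∪ {φ | ¬ GoodEv p n m ν K R Nn φ} := by
    intro φ _
    by_cases hg : GoodEv p n m ν K R Nn φ
    · left
      intro h ε e hε he htil h1 h2 hs' hb
      exact cs_final hs (linProbeMatrix p n m φ)
        (fun z hz => good_lower hp hn hm2 hnm φ K R X hK0 hR0 (by linarith) hmX Nn hN1 hN2 hRν hg z hz)
        h ε e hε he htil h1 h2 hs' hb
    · right; exact hg
  have h1 := (gm_mono hcover).trans (measureReal_union_le _ _)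
  have huniv : (gaussMeasure p m).real Set.univ = 1 := by simp
  rw [huniv] at h1
  change 1 - 200 * X⁻¹ ≤ (gaussMeasure p m).real S
  have e1 : Real.exp (- K ^ 2 / 2) = (X ^ 4)⁻¹ := by
    have : - K ^ 2 / 2 = - ((4 : ℕ) * L) := by rw [hK2]; push_cast; ring
    rw [this, Real.exp_neg, Real.exp_nat_mul, hL, Real.exp_log hXpos]
  rw [e1] at hprob
  have h2 : (m : ℝ) * (n * p) * (2 * (X ^ 4)⁻¹) ≤ 2 * X⁻¹ := by
    rw [← hXd]
    have : (m : ℝ) * X * (2 * (X ^ 4)⁻¹) ≤ X * X * (2 * (X ^ 4)⁻¹) := by gcongr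
    refine this.trans ?_
    have e3 : X * X * (2 * (X ^ 4)⁻¹) = 2 * X⁻¹ * X⁻¹ := by field_simp
    rw [e3]
    have : X⁻¹ ≤ 1 := inv_le_one_of_one_le₀ (by linarith)
    have : 0 < X⁻¹ := by positivity
    nlinarith
  have h3 : (ν : ℝ) * (X ^ 2)⁻¹ ≤ 3 * X⁻¹ := by
    have : (ν : ℝ) * (X ^ 2)⁻¹ ≤ (3 * X) * (X ^ 2)⁻¹ := by
      gcongr; linarith
    refine this.trans (le_of_eq ?_)
    field_simp
  have : 0 < X⁻¹ := by positivity
  linarith
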